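/- arXiv:2411.10792 — 2 statements merged into one kernel-verified Lean document; each statement's English description precedes it below -/
import Mathlib

section
/- Let n be a natural number and let A be a graph with at least n vertices, every finite subset of which is n-open. Then there exists a graph M containing A as an induced subgraph such that: (i) A ≤ₙ M; (ii) every finite subset of M is n-open; (iii) for every finite subset D ⊆ M and every subset S ⊆ D with |S| ≤ n, there are infinitely many vertices v ∈ M ∖ D whose set of neighbours in D is exactly S; (iv) the cardinality of M equals the cardinality of A plus ℵ₀; (v) for every graph N satisfying properties (ii) and (iii) (with M replaced by N) and every graph embedding h : A → N with h(A) ≤ₙ N, there is a graph embedding ĥ : M → N extending h with ĥ(M) ≤ₙ N. -/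
/-- `v` has at most `n` neighbours (in the graph `G`) lying in the set `X`. -/
def valencyLE {V : Type*} (G : SimpleGraph V) (v : V) (X : Set V) (n : ℕ) : Prop :=
  {x ∈ X | G.Adj v x}.encard ≤ n

/-- `B` is `n`-open over `A`. -/
def nOpenOver {V : Type*} (G : SimpleGraph V) (n : ℕ) (A B : Set V) : Prop :=
  ∀ C : Set V, C ⊆ B \ A → C.Finite → C.Nonempty →
    ∃ c ∈ C, valencyLE G c (A ∪ C) n

/-- `B` is `n`-open. -/
def nOpen {V : Type*} (G : SimpleGraph V) (n : ℕ) (B : Set V) : Prop :=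
  ∀ C : Set V, C ⊆ B → C.Finite → C.Nonempty →
    ∃ c ∈ C, valencyLE G c C n

/-- Property (iii): for every finite `D` and every `S ⊆ D` with `|S| ≤ n`, there are
infinitely many vertices outside `D` whose set of neighbours in `D` is exactly `S`. -/
def Generic {β : Type} (M : SimpleGraph β) (n : ℕ) : Prop :=
  ∀ D : Set β, D.Finite → ∀ S : Set β, S ⊆ D → S.encard ≤ n →
    {v : β | v ∉ D ∧ {x ∈ D | M.Adj v x} = S}.Infinite

theorem nOpenOver_insert {V : Type*} {N : SimpleGraph V} {n : ℕ} {P : Set V} {v : V}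
    (hP : nOpenOver N n P Set.univ) (hv : n ≤ {x ∈ P | N.Adj v x}.encard) :
    nOpenOver N n (insert v P) Set.univ := by
  intro C hC hfin hne
  by_cases hvP : v ∈ P
  · rw [Set.insert_eq_of_mem hvP] at hC ⊢
    exact hP C hC hfin hne
  have hCP : ∀ c ∈ C, c ≠ v ∧ c ∉ P := fun c hc => by
    simpa [not_or] using (hC hc).2
  obtain ⟨c, hc, hval⟩ := hP (insert v C) (by
    rintro c (rfl | hc)
    · exact ⟨trivial, hvP⟩
    · exact ⟨trivial, (hCP c hc).2⟩) (hfin.insert v) (Set.insert_nonempty _ _)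
  have hunion : insert v P ∪ C = P ∪ insert v C := by
    rw [Set.insert_union, Set.union_insert]
  rcases hc with rfl | hc
  · have hsub : {x ∈ P | N.Adj c x} ⊆ {x ∈ P ∪ insert c C | N.Adj c x} :=
      fun x hx => ⟨Or.inl hx.1, hx.2⟩
    have heq : {x ∈ P | N.Adj c x} = {x ∈ P ∪ insert c C | N.Adj c x} :=
      Set.Finite.eq_of_subset_of_encard_le
        (Set.finite_of_encard_le_coe ((Set.encard_le_encard hsub).trans hval))
        hsub (le_trans hval hv)
    obtain ⟨d, hd, hdval⟩ := hP C (fun d hd => ⟨trivial, (hCP d hd).2⟩) hfin hne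
    refine ⟨d, hd, le_trans (Set.encard_le_encard ?_) hdval⟩
    rintro x ⟨(rfl | hx) | hx, hadj⟩
    · have : d ∈ {y ∈ P | N.Adj x y} := heq ▸ ⟨Or.inr (Or.inr hd), hadj.symm⟩
      exact absurd this.1 (hCP d hd).2
    · exact ⟨Or.inl hx, hadj⟩
    · exact ⟨Or.inr hx, hadj⟩
  · exact ⟨c, hc, by rw [hunion]; exact hval⟩

/-- Being open over a set has finite character. -/
theorem nOpenOver_of_finite_subsets {V : Type*} {N : SimpleGraph V} {n : ℕ} {A : Set V}
    (h : ∀ F : Set V, F.Finite → F ⊆ A → ∃ A', F ⊆ A' ∧ A' ⊆ A ∧ nOpenOver N n A' Set.univ) :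
    nOpenOver N n A Set.univ := by
  intro C hC hfin hne
  by_contra! hcon
  have hwit : ∀ c : V, ∃ t : Set V, t.Finite ∧ t ⊆ A ∪ C ∧
      (c ∈ C → (n : ℕ∞) < {x ∈ t | N.Adj c x}.encard) := by
    intro c
    by_cases hc : c ∈ C
    · have hlt : ((n + 1 : ℕ) : ℕ∞) ≤ {x ∈ A ∪ C | N.Adj c x}.encard := by
        have := not_le.1 (hcon c hc)
        exact_mod_cast Order.add_one_le_of_lt this
      obtain ⟨t, ht, hcard⟩ := Set.exists_subset_encard_eq hlt
      refine ⟨t, Set.finite_of_encard_eq_coe hcard, fun x hx => (ht hx).1, fun _ => ?_⟩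
      have : {x ∈ t | N.Adj c x} = t := Set.sep_eq_self_iff_mem_true.2 fun x hx => (ht hx).2
      rw [this, hcard]
      exact_mod_cast Nat.lt_succ_self n
    · exact ⟨∅, Set.finite_empty, Set.empty_subset _, fun h => absurd h hc⟩
  choose t htfin htsub htcard using hwit
  obtain ⟨A', hFA', hA'A, hA'⟩ := h ((⋃ c ∈ C, t c) ∩ A)
    ((hfin.biUnion fun c _ => htfin c).inter_of_left A) Set.inter_subset_right
  obtain ⟨c, hc, hval⟩ := hA' C (fun c hc => ⟨trivial, fun hcA => (hC hc).2 (hA'A hcA)⟩) hfin hne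
  refine absurd (htcard c hc) (not_lt.2 (le_trans (Set.encard_le_encard ?_) hval))
  rintro x ⟨hx, hadj⟩
  refine ⟨?_, hadj⟩
  rcases htsub c hx with hxA | hxC
  · exact Or.inl (hFA' ⟨Set.mem_biUnion hc hx, hxA⟩)
  · exact Or.inr hxC

theorem nOpenOver_union {V : Type*} {N : SimpleGraph V} {n : ℕ} {P W : Set V}
    (hP : nOpenOver N n P Set.univ) (hW : ∀ v ∈ W, n ≤ {x ∈ P | N.Adj v x}.encard) :
    nOpenOver N n (P ∪ W) Set.univ := by
  have hfinite : ∀ F : Set V, F.Finite → F ⊆ W → nOpenOver N n (P ∪ F) Set.univ := by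
    intro F hF
    induction F, hF using Set.Finite.induction_on with
    | empty => intro _; simpa using hP
    | @insert v F _ _ ih =>
      intro hsub
      rw [Set.union_insert]
      refine nOpenOver_insert (ih ((Set.subset_insert _ _).trans hsub)) ?_
      exact (hW v (hsub (Set.mem_insert _ _))).trans
        (Set.encard_le_encard fun x hx => ⟨Or.inl hx.1, hx.2⟩)
  refine nOpenOver_of_finite_subsets fun F hF hFsub => ⟨P ∪ (F ∩ W), ?_, ?_, ?_⟩
  · intro x hx
    exact (hFsub hx).imp_right fun hxW => ⟨hx, hxW⟩
  · exact Set.union_subset_union_right _ Set.inter_subset_right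
  · exact hfinite _ (hF.inter_of_left W) Set.inter_subset_right

theorem neighbors_eq_of_encard_eq {V : Type*} {N : SimpleGraph V} {n : ℕ} {P R : Set V} {v : V}
    (hP : nOpenOver N n P Set.univ) (hv : v ∉ P) (hR : R ⊆ {x ∈ P | N.Adj v x})
    (hcard : R.encard = n) : {x ∈ P | N.Adj v x} = R := by
  obtain ⟨c, rfl, hval⟩ := hP {v} (by simpa using hv) (Set.finite_singleton v)
    (Set.singleton_nonempty v)
  have hle : {x ∈ P | N.Adj c x}.encard ≤ n := by
    refine le_trans (Set.encard_le_encard ?_) hval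
    exact fun x hx => ⟨Or.inl hx.1, hx.2⟩
  exact (Set.Finite.eq_of_subset_of_encard_le (Set.finite_of_encard_eq_coe hcard) hR
    (hle.trans hcard.ge)).symm

theorem not_adj_of_encard_eq {V : Type*} {N : SimpleGraph V} {n : ℕ} {P : Set V} {u v : V}
    (hP : nOpenOver N n P Set.univ) (hu : u ∉ P) (hv : v ∉ P)
    (hucard : {x ∈ P | N.Adj u x}.encard = n) (hvcard : {x ∈ P | N.Adj v x}.encard = n) :
    ¬ N.Adj u v := by
  intro hadj
  have hpair : ∀ w w' : V, w' ∉ P → N.Adj w w' → {x ∈ P | N.Adj w x}.encard = n →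
      w' ∈ ({u, v} : Set V) → ¬ valencyLE N w (P ∪ {u, v}) n := by
    intro w w' hw' hww' hcard hmem hval
    have hle : (insert w' {x ∈ P | N.Adj w x}).encard ≤ n := by
      refine le_trans (Set.encard_le_encard ?_) hval
      rintro x (rfl | hx)
      · exact ⟨Or.inr hmem, hww'⟩
      · exact ⟨Or.inl hx.1, hx.2⟩
    rw [Set.encard_insert_of_notMem fun h => hw' h.1, hcard] at hle
    have : n + 1 ≤ n := by exact_mod_cast hle
    omega
  obtain ⟨c, rfl | rfl, hval⟩ := hP {u, v} (by
    rintro x (rfl | rfl)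
    · exact ⟨trivial, hu⟩
    · exact ⟨trivial, hv⟩) (Set.toFinite _) (Set.insert_nonempty _ _)
  · exact hpair c v hv hadj hucard (by simp) hval
  · exact hpair c u hu hadj.symm hvcard (by simp) hval

/-- In an `n`-open graph, an outside vertex is adjacent to only finitely many common neighbours
of `n` given vertices, since the graph omits the bipartite graph on `n + 1` and `n + 1` vertices. -/
theorem nOpen_finite_commonNeighbors {V : Type*} {M : SimpleGraph V} {n : ℕ}
    (hM : nOpen M n Set.univ) {S : Set V} (hS : S.encard = n) {d : V} (hd : d ∉ S) :
    {v | (∀ s ∈ S, M.Adj v s) ∧ M.Adj v d}.Finite := by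
  by_contra hinf
  obtain ⟨U, hU, hUcard⟩ := Set.Infinite.exists_subset_card_eq hinf (n + 1)
  have hSfin : S.Finite := Set.finite_of_encard_eq_coe hS
  have hUe : (U : Set V).encard = ((n + 1 : ℕ) : ℕ∞) := by
    rw [Set.encard_coe_eq_coe_finsetCard, hUcard]
  have hSe : (insert d S).encard = ((n + 1 : ℕ) : ℕ∞) := by
    rw [Set.encard_insert_of_notMem hd, hS]; rfl
  have hadj : ∀ u ∈ U, ∀ s ∈ insert d S, M.Adj u s := by
    rintro u hu s (rfl | hs)
    · exact (hU hu).2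
    · exact (hU hu).1 s hs
  obtain ⟨c, hc, hval⟩ := hM (U ∪ insert d S) (Set.subset_univ _)
    (U.finite_toSet.union (hSfin.insert d)) ⟨d, Or.inr (Set.mem_insert _ _)⟩
  have hlarge : ((n + 1 : ℕ) : ℕ∞) ≤ n := by
    rcases hc with hc | hc
    · rw [← hSe]
      refine le_trans (Set.encard_le_encard ?_) hval
      exact fun s hs => ⟨Or.inr hs, hadj c hc s hs⟩
    · rw [← hUe]
      refine le_trans (Set.encard_le_encard ?_) hval
      exact fun u hu => ⟨Or.inl hu, (hadj u hu c hc).symm⟩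
  have : n + 1 ≤ n := by exact_mod_cast hlarge
  omega

theorem generic_of_infinite_commonNeighbors {β : Type} [Infinite β] {M : SimpleGraph β} {n : ℕ}
    (hM : nOpen M n Set.univ)
    (hcommon : ∀ S : Set β, S.encard = n → {v | ∀ s ∈ S, M.Adj v s}.Infinite) :
    Generic M n := by
  intro D hD S hSD hS
  obtain ⟨j, hj⟩ := ENat.ne_top_iff_exists.1 (ne_top_of_le_ne_top (ENat.natCast_ne_top n) hS)
  rw [← hj] at hS
  have hjn : j ≤ n := by exact_mod_cast hS
  obtain ⟨t, htD, htcard⟩ := Set.Infinite.exists_subset_card_eq hD.infinite_compl (n - j)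
  have hdisj : Disjoint S (t : Set β) :=
    Set.disjoint_left.2 fun x hx hxt => htD hxt (hSD hx)
  have hSt : (S ∪ t).encard = n := by
    rw [Set.encard_union_eq hdisj, ← hj, Set.encard_coe_eq_coe_finsetCard, htcard]
    exact_mod_cast Nat.add_sub_cancel' hjn
  have hbad : (D ∪ ⋃ d ∈ D \ (S ∪ t),
      {v | (∀ s ∈ S ∪ (t : Set β), M.Adj v s) ∧ M.Adj v d}).Finite :=
    hD.union (hD.sdiff.biUnion fun d hd => nOpen_finite_commonNeighbors hM hSt hd.2)
  refine ((hcommon _ hSt).sdiff hbad).mono ?_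
  rintro v ⟨hv, hvbad⟩
  refine ⟨fun hvD => hvbad (Or.inl hvD), Set.Subset.antisymm ?_ ?_⟩
  · rintro d ⟨hd, hadj⟩
    by_cases hdS : d ∈ S ∪ (t : Set β)
    · exact hdS.resolve_right fun hdt => htD hdt hd
    · have hmem : v ∈ {v | (∀ s ∈ S ∪ (t : Set β), M.Adj v s) ∧ M.Adj v d} := ⟨hv, hadj⟩
      exact absurd (Or.inr (Set.mem_iUnion₂.2 ⟨d, ⟨hd, hdS⟩, hmem⟩)) hvbad
  · exact fun s hs => ⟨hSD hs, hv s (Or.inl hs)⟩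

/-- Formal vertices of the free completion: a vertex of the original graph, or the `k`-th new
vertex attached to a given `n`-tuple. -/
inductive AttachTree (α : Type) (n : ℕ) : Type
  | base : α → AttachTree α n
  | node : (Fin n → AttachTree α n) → ℕ → AttachTree α n

namespace AttachTree

variable {α : Type} {n : ℕ}

/-- The height of a tree. -/
def rank : AttachTree α n → ℕ
  | base _ => 0
  | node f _ => (Finset.univ.sup fun i => rank (f i)) + 1

/-- The vertices to which a new vertex is attached. -/
def children : AttachTree α n → Set (AttachTree α n)
  | base _ => ∅
  | node f _ => Set.range f

theorem rank_lt_of_mem_children {x y : AttachTree α n} (h : y ∈ x.children) :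
    y.rank < x.rank := by
  cases x with
  | base a => exact h.elim
  | node f k =>
    obtain ⟨i, rfl⟩ := h
    exact Nat.lt_succ_of_le (Finset.le_sup (f := fun i => rank (f i)) (Finset.mem_univ i))

theorem finite_children (x : AttachTree α n) : x.children.Finite := by
  cases x with
  | base a => exact Set.finite_empty
  | node f k => exact Set.finite_range f

theorem encard_children_le (x : AttachTree α n) : x.children.encard ≤ n := by
  cases x with
  | base a => simp [children]
  | node f k =>
    rw [children, ← Set.image_univ]
    exact (Set.encard_image_le _ _).trans (by simp [Set.encard_univ])

theorem rank_node_le {f : Fin n → AttachTree α n} {k : ℕ} {y : AttachTree α n} (hy : 0 < y.rank)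
    (h : ∀ i, f i ∈ y.children) : (node f k).rank ≤ y.rank := by
  have : (Finset.univ.sup fun i => rank (f i)) ≤ y.rank - 1 :=
    Finset.sup_le fun i _ => Nat.le_sub_one_of_lt (rank_lt_of_mem_children (h i))
  rw [rank]
  omega

/-- A tree is valid if every new vertex is attached to `n` distinct valid vertices which do not
already have infinitely many common neighbours in the original graph. -/
inductive Valid (G : SimpleGraph α) : AttachTree α n → Prop
  | base (a : α) : Valid G (base a)
  | node (f : Fin n → AttachTree α n) (k : ℕ) (hinj : Function.Injective f)
      (hf : ∀ i, Valid G (f i))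
      (hfin : ∀ b : Fin n → α, (∀ i, f i = .base (b i)) → {a | ∀ i, G.Adj (b i) a}.Finite) :
      Valid G (node f k)

/-- Old vertices are joined as in `G`, and a new vertex is joined to its children. -/
def graph (G : SimpleGraph α) (n : ℕ) : SimpleGraph (AttachTree α n) where
  Adj x y := (∃ a b, x = base a ∧ y = base b ∧ G.Adj a b) ∨ y ∈ x.children ∨ x ∈ y.children
  symm := ⟨by
    rintro x y (⟨a, b, rfl, rfl, h⟩ | h | h)
    · exact Or.inl ⟨b, a, rfl, rfl, h.symm⟩
    · exact Or.inr (Or.inr h)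
    · exact Or.inr (Or.inl h)⟩
  loopless := ⟨by
    rintro x (⟨a, b, rfl, h, hadj⟩ | h | h)
    · cases h; exact hadj.ne rfl
    · exact (rank_lt_of_mem_children h).ne rfl
    · exact (rank_lt_of_mem_children h).ne rfl⟩

/-- The free completion of `G`. -/
def completion (G : SimpleGraph α) (n : ℕ) : SimpleGraph {x : AttachTree α n // Valid G x} :=
  (graph G n).comap Subtype.val

/-- The inclusion of a graph in its free completion. -/
def baseEmbedding (G : SimpleGraph α) (n : ℕ) : G ↪g completion G n where
  toFun a := ⟨base a, Valid.base a⟩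
  inj' a b h := by simpa using h
  map_rel_iff' := by
    intro a b
    refine ⟨?_, fun h => Or.inl ⟨a, b, rfl, rfl, h⟩⟩
    rintro (⟨a', b', ha, hb, h⟩ | h | h)
    · cases ha; cases hb; exact h
    · exact h.elim
    · exact h.elim

theorem mk_le (α : Type) (n : ℕ) :
    Cardinal.mk (AttachTree α n) ≤ Cardinal.mk α + Cardinal.aleph0 := by
  let arity : α ⊕ ℕ → Type := Sum.elim (fun _ => Fin 0) (fun _ => Fin n)
  have hfin : ∀ s, Finite (arity s) := by
    rintro (a | k)
    · exact inferInstanceAs (Finite (Fin 0))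
    · exact inferInstanceAs (Finite (Fin n))
  let enc : AttachTree α n → WType arity := fun x =>
    AttachTree.rec (motive := fun _ => WType arity)
      (fun a => WType.mk (Sum.inl a) (fun i : Fin 0 => i.elim0))
      (fun _ k ih => WType.mk (Sum.inr k) ih) x
  have henc : Function.Injective enc := by
    intro x
    induction x with
    | base a =>
      intro y h
      cases y with
      | base b => rw [Sum.inl.inj (WType.mk.inj h).1]
      | node g l => exact absurd (WType.mk.inj h).1 Sum.inl_ne_inr
    | node f k ih =>
      intro y h
      cases y with
      | base b => exact absurd (WType.mk.inj h).1 Sum.inr_ne_inl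
      | node g l =>
        obtain ⟨hkl, hfg⟩ := WType.mk.inj h
        obtain rfl := Sum.inr.inj hkl
        congr 1
        funext i
        exact ih i (congrFun (eq_of_heq hfg) i)
  refine (Cardinal.mk_le_of_injective henc).trans
    (WType.cardinalMk_le_max_aleph0_of_finite'.trans ?_)
  simp

variable {G : SimpleGraph α}

theorem nOpenOver_range_baseEmbedding :
    nOpenOver (completion G n) n (Set.range (baseEmbedding G n)) Set.univ := by
  intro C hC hfin hne
  obtain ⟨c, hc, hmax⟩ := hfin.exists_maximalFor (fun x => x.1.rank) C hne
  refine ⟨c, hc, le_trans ?_ c.1.encard_children_le⟩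
  rw [← Subtype.val_injective.encard_image]
  refine Set.encard_le_encard ?_
  rintro _ ⟨x, ⟨hx, hadj⟩, rfl⟩
  rcases hadj with ⟨a, b, ha, -, -⟩ | h | h
  · exact absurd ⟨a, Subtype.ext ha.symm⟩ (hC hc).2
  · exact h
  · have hlt := rank_lt_of_mem_children h
    rcases hx with ⟨a, rfl⟩ | hx
    · exact h.elim
    · exact absurd (hmax hx hlt.le) (not_le.2 hlt)

theorem nOpen_completion (hG : nOpen G n Set.univ) : nOpen (completion G n) n Set.univ := by
  intro C _ hfin hne
  by_cases hbase : C ⊆ Set.range (baseEmbedding G n)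
  · obtain ⟨C, rfl⟩ := Set.subset_range_iff_exists_image_eq.1 hbase
    obtain ⟨c, hc, hval⟩ := hG C (Set.subset_univ _)
      (hfin.of_finite_image (baseEmbedding G n).injective.injOn) hne.of_image
    refine ⟨_, Set.mem_image_of_mem _ hc, le_trans ?_ hval⟩
    rw [← (baseEmbedding G n).injective.encard_image]
    refine Set.encard_le_encard ?_
    rintro _ ⟨⟨x, hx, rfl⟩, hadj⟩
    exact ⟨x, ⟨hx, (baseEmbedding G n).map_rel_iff.1 hadj⟩, rfl⟩
  · obtain ⟨x, hxC, hx⟩ := Set.not_subset.1 hbase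
    obtain ⟨c, hc, hval⟩ := nOpenOver_range_baseEmbedding (G := G) (n := n)
      (C \ Set.range (baseEmbedding G n)) (fun y hy => ⟨trivial, hy.2⟩) hfin.sdiff ⟨x, hxC, hx⟩
    refine ⟨c, hc.1, le_trans (Set.encard_le_encard ?_) hval⟩
    rintro y ⟨hy, hadj⟩
    refine ⟨?_, hadj⟩
    rw [Set.union_sdiff_self]
    exact Or.inr hy

theorem infinite_commonNeighbors (S : Set {x : AttachTree α n // Valid G x})
    (hS : S.encard = n) : {v | ∀ s ∈ S, (completion G n).Adj v s}.Infinite := by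
  obtain ⟨T, rfl⟩ := (Set.finite_of_encard_eq_coe hS).exists_finset_coe
  rw [Set.encard_coe_eq_coe_finsetCard, Nat.cast_inj] at hS
  let p : Fin n ≃ T := (T.equivFinOfCardEq hS).symm
  by_cases hval : Valid G (node (fun i => (p i).1.1) 0)
  · refine Set.infinite_of_injective_forall_mem
      (f := fun k : ℕ => (⟨node (fun i => (p i).1.1) k, by
        cases hval with
        | node _ _ h₁ h₂ h₃ => exact Valid.node _ _ h₁ h₂ h₃⟩ : {x : AttachTree α n // Valid G x}))
      ?_ ?_
    · intro k l h
      simpa using h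
    · intro k s hs
      exact Or.inr (Or.inl ⟨p.symm ⟨s, hs⟩, by simp⟩)
  · have : ∃ b : Fin n → α, (∀ i, (p i).1.1 = base (b i)) ∧
        {a | ∀ i, G.Adj (b i) a}.Infinite := by
      by_contra! hcon
      refine hval (Valid.node _ _ ?_ (fun i => (p i).1.2)
        fun b hb => Set.not_infinite.1 fun h => ?_)
      · exact Subtype.val_injective.comp (Subtype.val_injective.comp p.injective)
      · exact h (hcon b hb)
    obtain ⟨b, hb, hinf⟩ := this
    refine (hinf.image (baseEmbedding G n).injective.injOn).mono ?_
    rintro _ ⟨a, ha, rfl⟩ s hs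
    have hsb : s = baseEmbedding G n (b (p.symm ⟨s, hs⟩)) :=
      Subtype.ext (by have := hb (p.symm ⟨s, hs⟩); rwa [p.apply_symm_apply] at this)
    rw [hsb]
    exact (baseEmbedding G n).map_rel_iff.2 (ha _).symm

theorem infinite_completion (hcard : (n : Cardinal) ≤ Cardinal.mk α) :
    Infinite {x : AttachTree α n // Valid G x} := by
  obtain ⟨T, hT⟩ := Cardinal.exists_finset_eq_card hcard
  refine Set.infinite_univ_iff.1 ((infinite_commonNeighbors
    (baseEmbedding G n '' (T : Set α)) ?_).mono (Set.subset_univ _))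
  rw [(baseEmbedding G n).injective.encard_image, Set.encard_coe_eq_coe_finsetCard, ← hT]

theorem mk_completion (hcard : (n : Cardinal) ≤ Cardinal.mk α) :
    Cardinal.mk {x : AttachTree α n // Valid G x} = Cardinal.mk α + Cardinal.aleph0 := by
  refine le_antisymm ((Cardinal.mk_subtype_le _).trans (mk_le α n)) ?_
  have := infinite_completion (G := G) hcard
  exact Cardinal.add_le_of_le (Cardinal.aleph0_le_mk _)
    (Cardinal.mk_le_of_injective (baseEmbedding G n).injective) (Cardinal.aleph0_le_mk _)

/-- Valid trees of rank at most `r`. -/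
def stage (G : SimpleGraph α) (n r : ℕ) : Set (AttachTree α n) :=
  {x | Valid G x ∧ x.rank ≤ r}

theorem finite_commonNeighbors_stage {r k : ℕ} {f : Fin n → AttachTree α n}
    (hval : Valid G (node f k)) (hr : r < (node f k).rank) :
    {y ∈ stage G n r | ∀ i, (graph G n).Adj (f i) y}.Finite := by
  have hfin : ∀ b : Fin n → α, (∀ i, f i = base (b i)) → {a | ∀ i, G.Adj (b i) a}.Finite := by
    cases hval with
    | node _ _ _ _ h => exact h
  have hbase : {y : AttachTree α n | ∃ a, y = base a ∧
      ∃ b : Fin n → α, (∀ i, f i = base (b i)) ∧ ∀ i, G.Adj (b i) a}.Finite := by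
    by_cases h : ∃ b : Fin n → α, ∀ i, f i = base (b i)
    · obtain ⟨b, hb⟩ := h
      refine ((hfin b hb).image base).subset ?_
      rintro _ ⟨a, rfl, b', hb', hadj⟩
      refine ⟨a, fun i => ?_, rfl⟩
      have : b i = b' i := by simpa using (hb i).symm.trans (hb' i)
      exact this ▸ hadj i
    · refine Set.finite_empty.subset ?_
      rintro _ ⟨a, rfl, b, hb, -⟩
      exact h ⟨b, hb⟩
  refine ((Set.finite_iUnion fun i => (f i).finite_children).union hbase).subset ?_
  rintro y ⟨⟨-, hy⟩, hadj⟩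
  by_cases hch : ∃ i, y ∈ (f i).children
  · exact Or.inl (Set.mem_iUnion.2 hch)
  · push Not at hch
    right
    cases y with
    | base a =>
      have : ∀ i, ∃ b, f i = base b ∧ G.Adj b a := by
        intro i
        rcases hadj i with ⟨b, a', hb, ha, h⟩ | h | h
        · cases ha; exact ⟨b, hb, h⟩
        · exact absurd h (hch i)
        · exact h.elim
      choose b hb using this
      exact ⟨a, rfl, b, fun i => (hb i).1, fun i => (hb i).2⟩
    | node q m =>
      have hsub : ∀ i, f i ∈ (node q m).children := by
        intro i
        rcases hadj i with ⟨b, a', hb, ha, h⟩ | h | h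
        · cases ha
        · exact absurd h (hch i)
        · exact h
      have := rank_node_le (k := k) (by simp [rank]) hsub
      omega


/-- A uniform choice of new vertices attached to given tuples outside given sets, with distinct
choices for distinct tuples with the same entries. -/
theorem exists_attaching_choice {γ : Type} [Nonempty γ] (N : SimpleGraph γ) (n : ℕ) (E : Set γ) :
    ∃ e : (Fin n → γ) → ℕ → γ, ∀ f : Fin n → γ,
      ({v | ∀ i, N.Adj v (f i)} \ E).Infinite →
        (∀ k, e f k ∉ E ∧ ∀ i, N.Adj (e f k) (f i)) ∧
        ∀ (f' : Fin n → γ) (k l : ℕ), Set.range f' = Set.range f → e f k = e f' l →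
          f = f' ∧ k = l := by
  have hseq : ∀ X : Set γ, ∃ s : ℕ → γ, X.Infinite → Function.Injective s ∧ ∀ k, s k ∈ X := by
    intro X
    by_cases hX : X.Infinite
    · exact ⟨fun k => hX.natEmbedding X k, fun _ =>
        ⟨Subtype.val_injective.comp (hX.natEmbedding X).injective,
          fun k => (hX.natEmbedding X k).2⟩⟩
    · exact ⟨fun _ => Classical.arbitrary γ, fun h => absurd h hX⟩
  have hcode : ∀ S : Set γ, ∃ c : (Fin n → γ) → ℕ, Set.InjOn c {f | Set.range f = S} := by
    intro S
    refine Set.countable_iff_exists_injOn.1 ?_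
    by_cases hS : S.Finite
    · refine ((Set.Finite.pi' fun _ : Fin n => hS).subset ?_).countable
      rintro f rfl i
      exact Set.mem_range_self i
    · refine Set.countable_empty.mono ?_
      rintro f rfl
      exact hS (Set.finite_range f)
  choose s hs using hseq
  choose c hc using hcode
  refine ⟨fun f k => s ({v | ∀ u ∈ Set.range f, N.Adj v u} \ E)
    (Nat.pair (c (Set.range f) f) k), fun f hf => ?_⟩
  have hX : ({v | ∀ u ∈ Set.range f, N.Adj v u} \ E).Infinite := by
    simpa only [Set.forall_mem_range] using hf
  obtain ⟨hinj, hmem⟩ := hs _ hX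
  refine ⟨fun k => ⟨(hmem _).2, fun i => (hmem _).1 _ (Set.mem_range_self i)⟩, ?_⟩
  intro f' k l hrange h
  dsimp only at h
  rw [hrange] at h
  obtain ⟨h₁, h₂⟩ := Nat.pair_eq_pair.1 (hinj h)
  exact ⟨hc _ rfl hrange h₁, h₂⟩

/-- `g` embeds the trees of rank at most `r` so that the ambient graph is `n`-open over the
image. -/
structure StageEmbedding {γ : Type} (G : SimpleGraph α) (N : SimpleGraph γ) (r : ℕ)
    (g : AttachTree α n → γ) : Prop where
  injOn : Set.InjOn g (stage G n r)
  adj_iff : ∀ x ∈ stage G n r, ∀ y ∈ stage G n r, N.Adj (g x) (g y) ↔ (graph G n).Adj x y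
  nOpenOver_image : nOpenOver N n (g '' stage G n r) Set.univ

variable {γ : Type} {N : SimpleGraph γ}

theorem exists_base_of_mem_stage_zero {x : AttachTree α n} (hx : x ∈ stage G n 0) :
    ∃ a, x = base a := by
  cases x with
  | base a => exact ⟨a, rfl⟩
  | node f k => exact absurd hx.2 (by simp [rank])

theorem StageEmbedding.zero (h : G ↪g N) (hopen : nOpenOver N n (Set.range h) Set.univ)
    {g : AttachTree α n → γ} (hg : ∀ a, g (base a) = h a) : StageEmbedding G N 0 g where
  injOn := by
    intro x hx y hy hxy
    obtain ⟨a, rfl⟩ := exists_base_of_mem_stage_zero hx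
    obtain ⟨b, rfl⟩ := exists_base_of_mem_stage_zero hy
    rw [hg, hg] at hxy
    rw [h.injective hxy]
  adj_iff := by
    intro x hx y hy
    obtain ⟨a, rfl⟩ := exists_base_of_mem_stage_zero hx
    obtain ⟨b, rfl⟩ := exists_base_of_mem_stage_zero hy
    rw [hg, hg, h.map_rel_iff]
    exact (baseEmbedding G n).map_rel_iff.symm
  nOpenOver_image := by
    convert hopen using 1
    ext v
    constructor
    · rintro ⟨x, hx, rfl⟩
      obtain ⟨a, rfl⟩ := exists_base_of_mem_stage_zero hx
      exact ⟨a, (hg a).symm⟩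
    · rintro ⟨a, rfl⟩
      exact ⟨base a, ⟨Valid.base a, le_rfl⟩, hg a⟩

theorem exists_node_of_rank_eq_succ {r : ℕ} {x : AttachTree α n} (hx : Valid G x)
    (hr : x.rank = r + 1) : ∃ f k, x = node f k ∧ Function.Injective f ∧ ∀ i, f i ∈ stage G n r := by
  cases hx with
  | base a => simp [rank] at hr
  | node f k hinj hf _ =>
    refine ⟨f, k, rfl, hinj, fun i => ⟨hf i, ?_⟩⟩
    have := rank_lt_of_mem_children (x := node f k) (Set.mem_range_self i)
    omega

theorem StageEmbedding.infinite_candidates {r k : ℕ} {g : AttachTree α n → γ}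
    (hg : StageEmbedding G N r g) (hN : Generic N n) {f : Fin n → AttachTree α n}
    (hval : Valid G (node f k)) (hr : r < (node f k).rank)
    (hf : ∀ i, f i ∈ stage G n r) :
    ({v | ∀ i, N.Adj v (g (f i))} \ g '' stage G n r).Infinite := by
  have hcard : (Set.range fun i => g (f i)).encard ≤ n := by
    rw [← Set.image_univ]
    exact (Set.encard_image_le _ _).trans (by simp [Set.encard_univ])
  have hinf : {v | ∀ i, N.Adj v (g (f i))}.Infinite := by
    refine (hN _ (Set.finite_range fun i => g (f i)) _ subset_rfl hcard).mono ?_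
    rintro v ⟨-, hv⟩ i
    have : g (f i) ∈ {x ∈ Set.range fun i => g (f i) | N.Adj v x} := by
      rw [hv]
      exact ⟨i, rfl⟩
    exact this.2
  refine (hinf.sdiff ((finite_commonNeighbors_stage hval hr).image g)).mono ?_
  rintro v ⟨hv, hnot⟩
  refine ⟨hv, ?_⟩
  rintro ⟨y, hy, rfl⟩
  exact hnot ⟨y, ⟨hy, fun i => (hg.adj_iff _ (hf i) _ hy).1 (hv i).symm⟩, rfl⟩

/-- An embedding of one stage into a generic graph extends to the next stage. -/
theorem exists_stageEmbedding_succ {r : ℕ} {g : AttachTree α n → γ}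
    (hg : StageEmbedding G N r g) (hN : Generic N n) :
    ∃ g' : AttachTree α n → γ,
      (∀ x ∈ stage G n r, g' x = g x) ∧ StageEmbedding G N (r + 1) g' := by
  classical
  have : Nonempty γ := by
    obtain ⟨v, -⟩ := (hN ∅ Set.finite_empty ∅ subset_rfl (by simp)).nonempty
    exact ⟨v⟩
  obtain ⟨e, he⟩ := exists_attaching_choice N n (g '' stage G n r)
  let g' : AttachTree α n → γ := fun x =>
    if x.rank ≤ r then g x else
      match x with
      | base a => g (base a)
      | node f k => e (fun i => g (f i)) k
  have hold : ∀ x ∈ stage G n r, g' x = g x := fun x hx => if_pos hx.2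
  have hmono : stage G n r ⊆ stage G n (r + 1) := fun x hx => ⟨hx.1, hx.2.trans (Nat.le_succ r)⟩
  have hnode : ∀ f k, r < (node f k : AttachTree α n).rank →
      g' (node f k) = e (fun i => g (f i)) k := fun f k h => if_neg (not_le.2 h)
  have hnew : ∀ x ∈ stage G n (r + 1), x ∉ stage G n r → ∃ f k, x = node f k ∧
      x.rank = r + 1 ∧ (∀ i, f i ∈ stage G n r) ∧ g' x = e (fun i => g (f i)) k ∧
      g' x ∉ g '' stage G n r ∧
      {u ∈ g '' stage G n r | N.Adj (g' x) u} = (Set.range fun i => g (f i)) ∧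
      (Set.range fun i => g (f i)).encard = n ∧
      ∀ (f' : Fin n → γ) (l : ℕ), Set.range f' = (Set.range fun i => g (f i)) →
        e (fun i => g (f i)) k = e f' l → (fun i => g (f i)) = f' ∧ k = l := by
    intro x hx hxr
    have hrank : x.rank = r + 1 := le_antisymm hx.2 (Nat.lt_of_not_le fun h => hxr ⟨hx.1, h⟩)
    obtain ⟨f, k, rfl, hinj, hf⟩ := exists_node_of_rank_eq_succ hx.1 hrank
    obtain ⟨hadj, huniq⟩ := he _ (hg.infinite_candidates hN hx.1 (by omega) hf)
    have hval := hnode f k (by omega)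
    have hcard : (Set.range fun i => g (f i)).encard = n := by
      have hinj' : Function.Injective fun i => g (f i) :=
        fun i j hij => hinj (hg.injOn (hf i) (hf j) hij)
      rw [← Set.image_univ, hinj'.encard_image]
      simp [Set.encard_univ]
    refine ⟨f, k, rfl, hrank, hf, hval, hval ▸ (hadj k).1, ?_, hcard, fun f' l => huniq f' k l⟩
    refine neighbors_eq_of_encard_eq hg.nOpenOver_image (hval ▸ (hadj k).1) ?_ hcard
    rintro _ ⟨i, rfl⟩
    exact ⟨⟨f i, hf i, rfl⟩, hval ▸ (hadj k).2 i⟩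
  have hadj_old_new : ∀ x ∈ stage G n r, ∀ y ∈ stage G n (r + 1), y ∉ stage G n r →
      (N.Adj (g' y) (g' x) ↔ (graph G n).Adj y x) := by
    intro x hx y hy hyr
    obtain ⟨f, k, rfl, hrank, hf, -, -, hnbr, -, -⟩ := hnew y hy hyr
    rw [hold x hx]
    have hmem : N.Adj (g' (node f k)) (g x) ↔ g x ∈ Set.range fun i => g (f i) := by
      rw [← hnbr]
      exact ⟨fun h => ⟨⟨x, hx, rfl⟩, h⟩, fun h => h.2⟩
    rw [hmem]
    constructor
    · rintro ⟨i, hi⟩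
      exact Or.inr (Or.inl ⟨i, hg.injOn (hf i) hx hi⟩)
    · rintro (⟨a, b, h, -⟩ | ⟨i, hi⟩ | h)
      · cases h
      · exact ⟨i, congrArg g hi⟩
      · have := rank_lt_of_mem_children h
        have := hx.2
        omega
  refine ⟨g', hold, ?_, ?_, ?_⟩
  · intro x hx y hy hxy
    by_cases hxr : x ∈ stage G n r <;> by_cases hyr : y ∈ stage G n r
    · rw [hold x hxr, hold y hyr] at hxy
      exact hg.injOn hxr hyr hxy
    · obtain ⟨-, -, -, -, -, -, hnot, -⟩ := hnew y hy hyr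
      exact absurd ⟨x, hxr, (hold x hxr).symm.trans hxy⟩ hnot
    · obtain ⟨-, -, -, -, -, -, hnot, -⟩ := hnew x hx hxr
      exact absurd ⟨y, hyr, (hold y hyr).symm.trans hxy.symm⟩ hnot
    · obtain ⟨f, k, rfl, -, hf, hx', -, hnbr, -, huniq⟩ := hnew x hx hxr
      obtain ⟨f', l, rfl, -, hf', hy', -, hnbr', -, -⟩ := hnew y hy hyr
      obtain ⟨hff, rfl⟩ := huniq (fun i => g (f' i)) l (by rw [← hnbr, ← hnbr', hxy])
        (by rw [← hx', ← hy', hxy])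
      congr 1
      funext i
      exact hg.injOn (hf i) (hf' i) (congrFun hff i)
  · intro x hx y hy
    by_cases hxr : x ∈ stage G n r <;> by_cases hyr : y ∈ stage G n r
    · rw [hold x hxr, hold y hyr]
      exact hg.adj_iff x hxr y hyr
    · rw [N.adj_comm, (graph G n).adj_comm]
      exact hadj_old_new x hxr y hy hyr
    · exact hadj_old_new y hyr x hx hxr
    · obtain ⟨f, k, rfl, hrank, -, -, hnot, hnbr, hcard, -⟩ := hnew x hx hxr
      obtain ⟨f', l, rfl, hrank', -, -, hnot', hnbr', hcard', -⟩ := hnew y hy hyr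
      refine iff_of_false ?_ ?_
      · exact not_adj_of_encard_eq hg.nOpenOver_image hnot hnot' (hnbr ▸ hcard) (hnbr' ▸ hcard')
      · rintro (⟨a, b, h, -⟩ | h | h)
        · cases h
        · have := rank_lt_of_mem_children h
          omega
        · have := rank_lt_of_mem_children h
          omega
  · have himage : g' '' stage G n (r + 1) =
        g '' stage G n r ∪ g' '' (stage G n (r + 1) \ stage G n r) := by
      rw [← Set.image_congr hold, ← Set.image_union, Set.union_sdiff_cancel hmono]
    rw [himage]
    refine nOpenOver_union hg.nOpenOver_image ?_
    rintro _ ⟨x, ⟨hx, hxr⟩, rfl⟩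
    obtain ⟨f, -, -, -, -, -, -, hnbr, hcard, -⟩ := hnew x hx hxr
    rw [hnbr, hcard]

theorem exists_embedding (hN : Generic N n) (h : G ↪g N)
    (hopen : nOpenOver N n (Set.range h) Set.univ) :
    ∃ hh : completion G n ↪g N, (∀ a, hh (baseEmbedding G n a) = h a) ∧
      nOpenOver N n (Set.range hh) Set.univ := by
  obtain ⟨v, -⟩ := (hN ∅ Set.finite_empty ∅ subset_rfl (by simp)).nonempty
  let g₀ : AttachTree α n → γ := fun x =>
    match x with
    | base a => h a
    | node _ _ => v
  choose! step hstep_eq hstep using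
    fun (r : ℕ) (g : AttachTree α n → γ) (hg : StageEmbedding G N r g) =>
      exists_stageEmbedding_succ hg hN
  let g : ℕ → AttachTree α n → γ := fun r => Nat.rec g₀ step r
  have hg : ∀ r, StageEmbedding G N r (g r) := by
    intro r
    induction r with
    | zero => exact StageEmbedding.zero h hopen fun _ => rfl
    | succ r ih => exact hstep r (g r) ih
  have hcoh : ∀ {r s : ℕ}, r ≤ s → ∀ x ∈ stage G n r, g s x = g r x := by
    intro r s hrs x hx
    induction s, hrs using Nat.le_induction with
    | base => rfl
    | succ s hrs ih => exact (hstep_eq s (g s) (hg s) x ⟨hx.1, hx.2.trans hrs⟩).trans ih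
  let hh : {x : AttachTree α n // Valid G x} → γ := fun x => g x.1.rank x.1
  have hhg : ∀ (r : ℕ) (x : {x : AttachTree α n // Valid G x}), x.1.rank ≤ r → hh x = g r x.1 :=
    fun r x hr => (hcoh hr x.1 ⟨x.2, le_rfl⟩).symm
  have hinj : Function.Injective hh := by
    intro x y hxy
    rw [hhg _ x (le_max_left _ y.1.rank), hhg _ y (le_max_right x.1.rank _)] at hxy
    exact Subtype.ext ((hg _).injOn ⟨x.2, le_max_left _ _⟩ ⟨y.2, le_max_right _ _⟩ hxy)
  refine ⟨⟨⟨hh, hinj⟩, ?_⟩, fun a => rfl, ?_⟩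
  · intro x y
    change N.Adj (hh x) (hh y) ↔ _
    rw [hhg _ x (le_max_left _ y.1.rank), hhg _ y (le_max_right x.1.rank _)]
    exact (hg _).adj_iff _ ⟨x.2, le_max_left _ _⟩ _ ⟨y.2, le_max_right _ _⟩
  · refine nOpenOver_of_finite_subsets fun F hF hFsub => ?_
    obtain ⟨X, rfl⟩ := Set.subset_range_iff_exists_image_eq.1 hFsub
    obtain ⟨r, hr⟩ := ((hF.of_finite_image hinj.injOn).image fun x => x.1.rank).bddAbove
    refine ⟨g r '' stage G n r, ?_, ?_, (hg r).nOpenOver_image⟩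
    · rintro _ ⟨x, hx, rfl⟩
      have hxr : x.1.rank ≤ r := hr ⟨x, hx, rfl⟩
      exact ⟨x.1, ⟨x.2, hxr⟩, (hhg r x hxr).symm⟩
    · rintro _ ⟨x, hx, rfl⟩
      exact ⟨⟨x, hx.1⟩, hhg r ⟨x, hx.1⟩ hx.2⟩

end AttachTree

theorem stmt3 {α : Type} (G : SimpleGraph α) (n : ℕ)
    (hcard : (n : Cardinal) ≤ Cardinal.mk α)
    (hopen : nOpen G n (Set.univ : Set α)) :
    ∃ (β : Type) (M : SimpleGraph β) (ι : G ↪g M),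
      nOpenOver M n (Set.range ι) Set.univ ∧
      nOpen M n (Set.univ : Set β) ∧
      Generic M n ∧
      Cardinal.mk β = Cardinal.mk α + Cardinal.aleph0 ∧
      (∀ (γ : Type) (N : SimpleGraph γ),
        nOpen N n (Set.univ : Set γ) → Generic N n →
        ∀ h : G ↪g N, nOpenOver N n (Set.range h) Set.univ →
          ∃ hh : M ↪g N, (∀ a : α, hh (ι a) = h a) ∧
            nOpenOver N n (Set.range hh) Set.univ) := by
  refine ⟨_, AttachTree.completion G n, AttachTree.baseEmbedding G n,
    AttachTree.nOpenOver_range_baseEmbedding, AttachTree.nOpen_completion hopen, ?_,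
    AttachTree.mk_completion hcard,
    fun γ N _ hN h hh => AttachTree.exists_embedding hN h hh⟩
  have := AttachTree.infinite_completion (G := G) hcard
  exact generic_of_infinite_commonNeighbors (AttachTree.nOpen_completion hopen)
    AttachTree.infinite_commonNeighbors
end

section
/- Fix integers k, n with 2 ≤ k < n. Let A be a partial (k,n)-Steiner system every finite subset of which is open, containing at least k+1 points and at least k+1 blocks. Then there exists a partial (k,n)-Steiner system F with A ⊆ F such that: (i) A ≤_o F; (ii) every finite subset of F is open; (iii) any k distinct points of F are incident with exactly one common block of F; (iv) every block of F is incident with exactly n points of F; (v) for every finite subset D ⊆ F and every set S of at most k−1 points of D, there are infinitely many blocks of F incident with every point of S and incident with no other point of D; (vi) for every finite subset D ⊆ F there are infinitely many points of F incident with no block of D; (vii) the cardinality of F equals the cardinality of A plus ℵ₀; (viii) for every partial (k,n)-Steiner system M satisfying properties (ii)–(vi) (with F replaced by M) and every embedding h : A → M with h(A) ≤_o M, there is an embedding ĥ : F → M extending h with ĥ(F) ≤_o M. -/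
namespace Steiner

variable {P L : Type}

/-- The blocks of `X` incident with the point `p`. -/
def blocksIn (I : P → L → Prop) (X : Set (P ⊕ L)) (p : P) : Set L :=
  {b : L | Sum.inr b ∈ X ∧ I p b}

/-- The points of `X` incident with the block `b`. -/
def pointsIn (I : P → L → Prop) (X : Set (P ⊕ L)) (b : L) : Set P :=
  {p : P | Sum.inl p ∈ X ∧ I p b}

/-- An element is hyperfree in `X` if it is a point incident with at most one block of `X`,
or a block incident with at most `k` points of `X`. -/
def Hyperfree (k : ℕ) (I : P → L → Prop) (X : Set (P ⊕ L)) : (P ⊕ L) → Prop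
  | Sum.inl p => (blocksIn I X p).encard ≤ 1
  | Sum.inr b => (pointsIn I X b).encard ≤ k

/-- `B` is open over `A`: every nonempty finite subset `C` of `B \ A` contains an element
that is hyperfree in `A ∪ C`. -/
def OpenOver (k : ℕ) (I : P → L → Prop) (A B : Set (P ⊕ L)) : Prop :=
  ∀ C : Set (P ⊕ L), C ⊆ B \ A → C.Finite → C.Nonempty →
    ∃ c ∈ C, Hyperfree k I (A ∪ C) c

/-- `B` is open: every nonempty finite subset `C` of `B` contains an element hyperfree in `C`. -/
def IsOpen (k : ℕ) (I : P → L → Prop) (B : Set (P ⊕ L)) : Prop :=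
  ∀ C : Set (P ⊕ L), C ⊆ B → C.Finite → C.Nonempty →
    ∃ c ∈ C, Hyperfree k I C c

/-- `X` with the incidence relation `I` is a partial `(k,n)`-Steiner system: any `k` distinct
points of `X` are incident with at most one common block of `X`, and every block of `X` is
incident with at most `n` points of `X`. -/
def IsPartial (k n : ℕ) (I : P → L → Prop) (X : Set (P ⊕ L)) : Prop :=
  (∀ S : Set P, (∀ p ∈ S, Sum.inl p ∈ X) → S.encard = k →
    ∀ b b' : L, Sum.inr b ∈ X → Sum.inr b' ∈ X →
      (∀ p ∈ S, I p b) → (∀ p ∈ S, I p b') → b = b') ∧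
  (∀ b : L, Sum.inr b ∈ X → (pointsIn I X b).encard ≤ n)

end Steiner

open Steiner

/-- Properties (ii)–(vi) of the free completion: every finite subset open; any `k` distinct
points incident with exactly one common block; every block incident with exactly `n` points;
for every finite `D` and set `S` of at most `k−1` points of `D` infinitely many blocks
incident with every point of `S` and with no other point of `D`; for every finite `D`
infinitely many points incident with no block of `D`. -/
def SteinerGeneric (k n : ℕ) {P' L' : Type} (I' : P' → L' → Prop) : Prop :=
  IsOpen k I' (Set.univ : Set (P' ⊕ L')) ∧
  (∀ S : Set P', S.encard = k → ∃! b : L', ∀ p ∈ S, I' p b) ∧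
  (∀ b : L', ({p : P' | I' p b}).encard = n) ∧
  (∀ D : Set (P' ⊕ L'), D.Finite → ∀ S : Set P',
    (∀ p ∈ S, Sum.inl p ∈ D) → S.encard ≤ ((k - 1 : ℕ) : ℕ∞) →
    ({b : L' | (∀ p ∈ S, I' p b) ∧ ∀ p : P', Sum.inl p ∈ D → I' p b → p ∈ S}).Infinite) ∧
  (∀ D : Set (P' ⊕ L'), D.Finite →
    ({p : P' | ∀ b : L', Sum.inr b ∈ D → ¬ I' p b}).Infinite)

namespace Steiner

section Openness

variable {P L : Type} {k : ℕ} {I : P → L → Prop}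

/-- Symmetrised incidence on the disjoint union of points and blocks. -/
def Adj (I : P → L → Prop) : P ⊕ L → P ⊕ L → Prop
  | Sum.inl p, Sum.inr b => I p b
  | Sum.inr b, Sum.inl p => I p b
  | _, _ => False

/-- The elements of `X` incident with `x`. -/
def nbrs (I : P → L → Prop) (X : Set (P ⊕ L)) (x : P ⊕ L) : Set (P ⊕ L) :=
  {y | y ∈ X ∧ Adj I x y}

/-- The largest number of incidences a hyperfree element may have. -/
def bound (k : ℕ) : P ⊕ L → ℕ
  | Sum.inl _ => 1
  | Sum.inr _ => k

theorem Adj.symm {x y : P ⊕ L} (h : Adj I x y) : Adj I y x := by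
  cases x <;> cases y <;> exact h

theorem nbrs_inl (X : Set (P ⊕ L)) (p : P) :
    nbrs I X (Sum.inl p) = Sum.inr '' blocksIn I X p := by
  ext (q | b) <;> simp [nbrs, Adj, blocksIn]

theorem nbrs_inr (X : Set (P ⊕ L)) (b : L) :
    nbrs I X (Sum.inr b) = Sum.inl '' pointsIn I X b := by
  ext (q | b) <;> simp [nbrs, Adj, pointsIn]

theorem hyperfree_iff {X : Set (P ⊕ L)} {x : P ⊕ L} :
    Hyperfree k I X x ↔ (nbrs I X x).encard ≤ bound k x := by
  cases x with
  | inl p => simp [Hyperfree, bound, nbrs_inl, Sum.inr_injective.encard_image]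
  | inr b => simp [Hyperfree, bound, nbrs_inr, Sum.inl_injective.encard_image]

theorem nbrs_mono {X Y : Set (P ⊕ L)} (h : X ⊆ Y) (x : P ⊕ L) : nbrs I X x ⊆ nbrs I Y x :=
  fun _ hy => ⟨h hy.1, hy.2⟩

theorem Hyperfree.anti {X Y : Set (P ⊕ L)} {x : P ⊕ L} (hx : Hyperfree k I Y x) (h : X ⊆ Y) :
    Hyperfree k I X x :=
  hyperfree_iff.2 ((Set.encard_le_encard (nbrs_mono h x)).trans (hyperfree_iff.1 hx))

theorem exists_finite_not_hyperfree {X : Set (P ⊕ L)} {x : P ⊕ L} (h : ¬ Hyperfree k I X x) :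
    ∃ W ⊆ nbrs I X x, W.Finite ∧ ¬ Hyperfree k I W x := by
  rw [hyperfree_iff, not_le] at h
  obtain ⟨W, hW, hc⟩ := Set.exists_subset_encard_eq (Order.add_one_le_of_lt h)
  refine ⟨W, hW, Set.finite_of_encard_eq_coe (k := bound k x + 1) (by rw [hc]; norm_cast), ?_⟩
  have : nbrs I W x = W := Set.Subset.antisymm (fun _ hy => hy.1) fun y hy => ⟨hy, (hW hy).2⟩
  rw [hyperfree_iff, this, hc, not_le]
  exact_mod_cast Nat.lt_succ_self _

/-- An element saturated over `Y` with a further neighbour outside `Y` is not hyperfree. -/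
theorem not_hyperfree_of_adj {X Y : Set (P ⊕ L)} {z w : P ⊕ L} (hYX : Y ⊆ X)
    (hz : bound k z ≤ (nbrs I Y z).encard) (hwX : w ∈ X) (hwY : w ∉ Y) (hzw : Adj I z w) :
    ¬ Hyperfree k I X z := by
  rw [hyperfree_iff, not_le]
  have hsub : insert w (nbrs I Y z) ⊆ nbrs I X z :=
    Set.insert_subset ⟨hwX, hzw⟩ (nbrs_mono hYX z)
  refine lt_of_lt_of_le ?_ (Set.encard_le_encard hsub)
  rw [Set.encard_insert_of_notMem fun h => hwY h.1]
  calc (bound k z : ℕ∞) < bound k z + 1 := by exact_mod_cast Nat.lt_succ_self _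
    _ ≤ _ := by gcongr

theorem OpenOver.encard_nbrs_le {Y : Set (P ⊕ L)} (hY : OpenOver k I Y Set.univ) {z : P ⊕ L}
    (hz : z ∉ Y) : (nbrs I Y z).encard ≤ bound k z := by
  obtain ⟨c, rfl, hc⟩ := hY {z} (by simpa using hz) (Set.finite_singleton z) ⟨z, rfl⟩
  exact hyperfree_iff.1 (hc.anti Set.subset_union_left)

theorem OpenOver.not_adj_of_saturated {Y : Set (P ⊕ L)} (hY : OpenOver k I Y Set.univ)
    {z w : P ⊕ L} (hzY : z ∉ Y) (hwY : w ∉ Y) (hz : bound k z ≤ (nbrs I Y z).encard)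
    (hw : bound k w ≤ (nbrs I Y w).encard) : ¬ Adj I z w := by
  intro hzw
  obtain ⟨c, hc, hfree⟩ := hY {z, w} (by rintro x (rfl | rfl) <;> simpa)
    (Set.toFinite _) ⟨z, by simp⟩
  rcases hc with rfl | rfl
  · exact not_hyperfree_of_adj Set.subset_union_left hz (by simp) hwY hzw hfree
  · exact not_hyperfree_of_adj Set.subset_union_left hw (by simp) hzY hzw.symm hfree

/-- Adjoining elements saturated over `Y` preserves openness. -/
theorem OpenOver.union_saturated {Y Z : Set (P ⊕ L)} (hY : OpenOver k I Y Set.univ)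
    (hZY : ∀ z ∈ Z, z ∉ Y) (hZ : ∀ z ∈ Z, bound k z ≤ (nbrs I Y z).encard) :
    OpenOver k I (Y ∪ Z) Set.univ := by
  intro C hC hCfin hCne
  by_contra! hnot
  have hw : ∀ c ∈ C, ∃ W ⊆ nbrs I (Y ∪ Z ∪ C) c, W.Finite ∧ ¬ Hyperfree k I W c :=
    fun c hc => exists_finite_not_hyperfree (hnot c hc)
  choose! W hWsub hWfin hW using hw
  set Z₀ := {z | z ∈ Z ∧ ∃ c ∈ C, z ∈ W c} with hZ₀
  have hZ₀fin : Z₀.Finite := (hCfin.biUnion hWfin).subset fun z hz => by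
    obtain ⟨c, hc, hz⟩ := hz.2
    exact Set.mem_biUnion hc hz
  obtain ⟨c, hc, hfree⟩ := hY (C ∪ Z₀)
    (by
      rintro x (hx | hx)
      · exact ⟨trivial, fun h => (hC hx).2 (Or.inl h)⟩
      · exact ⟨trivial, hZY x hx.1⟩)
    (hCfin.union hZ₀fin) hCne.inl
  rcases hc with hc | ⟨hcZ, d, hd, hcd⟩
  · refine hW c hc (hfree.anti fun x hx => ?_)
    rcases (hWsub c hc hx).1 with (h | h) | h
    · exact Or.inl h
    · exact Or.inr (Or.inr ⟨h, c, hc, hx⟩)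
    · exact Or.inr (Or.inl h)
  · exact not_hyperfree_of_adj Set.subset_union_left (hZ c hcZ) (Or.inr (Or.inl hd))
      (fun h => (hC hd).2 (Or.inl h)) (hWsub d hd hcd).2.symm hfree

theorem OpenOver.iUnion {Y : ℕ → Set (P ⊕ L)} (hmono : Monotone Y)
    (hY : ∀ r, OpenOver k I (Y r) Set.univ) : OpenOver k I (⋃ r, Y r) Set.univ := by
  intro C hC hCfin hCne
  by_contra! hnot
  have hw : ∀ c ∈ C, ∃ W ⊆ nbrs I ((⋃ r, Y r) ∪ C) c, W.Finite ∧ ¬ Hyperfree k I W c :=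
    fun c hc => exists_finite_not_hyperfree (hnot c hc)
  choose! W hWsub hWfin hW using hw
  have hfin : ((⋃ c ∈ C, W c) \ C).Finite := (hCfin.biUnion hWfin).sdiff
  have hsub : (⋃ c ∈ C, W c) \ C ⊆ ⋃ r, Y r := by
    rintro x ⟨hx, hxC⟩
    obtain ⟨c, hc, hx⟩ := Set.mem_iUnion₂.1 hx
    exact (hWsub c hc hx).1.resolve_right hxC
  obtain ⟨r, hr⟩ := Directed.exists_mem_subset_of_finset_subset_biUnion hmono.directed_le
    (s := hfin.toFinset) (by simpa using hsub)
  rw [hfin.coe_toFinset] at hr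
  obtain ⟨c, hc, hfree⟩ := hY r C
    (fun x hx => ⟨trivial, fun h => (hC hx).2 (Set.mem_iUnion_of_mem r h)⟩) hCfin hCne
  refine hW c hc (hfree.anti fun x hx => ?_)
  by_cases hxC : x ∈ C
  · exact Or.inr hxC
  · exact Or.inl (hr ⟨Set.mem_biUnion hc hx, hxC⟩)

/-- An open extension of an open system is open. -/
theorem IsOpen.of_openOver {A : Set (P ⊕ L)} (hA : IsOpen k I A)
    (h : OpenOver k I A Set.univ) : IsOpen k I Set.univ := by
  intro C _ hCfin hCne
  by_cases hCA : C ⊆ A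
  · exact hA C hCA hCfin hCne
  · obtain ⟨c, hc, hfree⟩ := h (C \ A) (fun x hx => ⟨trivial, hx.2⟩) hCfin.sdiff
      (Set.sdiff_nonempty.2 hCA)
    exact ⟨c, hc.1, hfree.anti fun x hx => by by_cases x ∈ A <;> simp_all⟩

theorem IsOpen.range {P' L' : Type} {I' : P' → L' → Prop} {ip : P → P'} {il : L → L'}
    (hip : ip.Injective) (hil : il.Injective) (hI : ∀ p b, I' (ip p) (il b) ↔ I p b)
    (h : IsOpen k I Set.univ) : IsOpen k I' (Set.range (Sum.map ip il)) := by
  intro C hC hCfin hCne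
  obtain ⟨C, rfl⟩ := Set.subset_range_iff_exists_image_eq.1 hC
  have hinj : (Sum.map ip il).Injective := hip.sumMap hil
  obtain ⟨c, hc, hfree⟩ := h C (Set.subset_univ C) (hCfin.of_finite_image hinj.injOn)
    hCne.of_image
  refine ⟨_, Set.mem_image_of_mem _ hc, ?_⟩
  rw [hyperfree_iff] at hfree ⊢
  have hb : bound k (Sum.map ip il c) = bound k c := by cases c <;> rfl
  have hnb : nbrs I' (Sum.map ip il '' C) (Sum.map ip il c) = Sum.map ip il '' nbrs I C c := by
    have hadj : ∀ x, Adj I' (Sum.map ip il c) (Sum.map ip il x) ↔ Adj I c x := by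
      intro x
      cases c <;> cases x <;> simp [Adj, hI]
    ext y
    constructor
    · rintro ⟨⟨x, hx, rfl⟩, hy⟩
      exact ⟨x, ⟨hx, (hadj x).1 hy⟩, rfl⟩
    · rintro ⟨x, ⟨hx, hy⟩, rfl⟩
      exact ⟨⟨x, hx, rfl⟩, (hadj x).2 hy⟩
  rwa [hnb, hinj.encard_image, hb]

end Openness

section Completeness

variable {P L : Type} {k n : ℕ} {I : P → L → Prop}

/-- A complete open system with at least two blocks has infinitely many points. -/
theorem infinite_points_of_complete (hk : 2 ≤ k) (hkn : k < n)
    (hopen : IsOpen k I Set.univ)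
    (hline : ∀ S : Set P, S.encard = k → ∃! b : L, ∀ p ∈ S, I p b)
    (hcard : ∀ b : L, {p : P | I p b}.encard = n) (hL : Nontrivial L) : Infinite P := by
  by_contra hfin
  rw [not_infinite_iff_finite] at hfin
  have hkn' : (k : ℕ∞) < n := by exact_mod_cast hkn
  have hinj : Function.Injective fun b : L => {p : P | I p b} := by
    intro b c hbc
    obtain ⟨S, hS, hSk⟩ := Set.exists_subset_encard_eq ((hkn'.le).trans (hcard b).ge)
    exact (hline S hSk).unique (fun p hp => hS hp)
      (fun p hp => (Set.ext_iff.1 hbc p).1 (hS hp))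
  have : Finite L := Finite.of_injective _ hinj
  obtain ⟨b₁, b₂, hne⟩ := hL
  obtain ⟨c, -, hc⟩ := hopen Set.univ subset_rfl Set.finite_univ ⟨Sum.inr b₁, trivial⟩
  cases c with
  | inr b =>
    have : (n : ℕ∞) ≤ k := by simpa [Hyperfree, pointsIn, hcard] using hc
    exact absurd this (not_le.2 hkn')
  | inl p =>
    have hp : ∀ b c, I p b → I p c → b = c := by
      simpa [Hyperfree, blocksIn, Set.encard_le_one_iff] using hc
    have hle : (k : ℕ∞) ≤ (Set.univ : Set P).encard :=
      hkn'.le.trans ((hcard b₁).ge.trans (Set.encard_le_encard (Set.subset_univ _)))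
    have hthrough : ∀ q, ∃ b, I p b ∧ I q b := by
      intro q
      obtain ⟨S, hS, -, hSk⟩ := Set.exists_superset_subset_encard_eq
        (Set.subset_univ {p, q}) ((Set.encard_insert_le {q} p).trans (by
          rw [Set.encard_singleton, one_add_one_eq_two]; exact_mod_cast hk)) hle
      obtain ⟨b, hb, -⟩ := hline S hSk
      exact ⟨b, hb p (hS (by simp)), hb q (hS (by simp))⟩
    obtain ⟨b₀, hb₀, -⟩ := hthrough p
    have hall : ∀ q, I q b₀ := by
      intro q
      obtain ⟨b, hpb, hqb⟩ := hthrough q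
      exact hp b b₀ hpb hb₀ ▸ hqb
    have huniq : ∀ b, b = b₀ := by
      intro b
      obtain ⟨S, hS, hSk⟩ := Set.exists_subset_encard_eq ((hkn'.le).trans (hcard b).ge)
      exact (hline S hSk).unique (fun p hp => hS hp) fun p _ => hall p
    exact hne ((huniq b₁).trans (huniq b₂).symm)

/-- In a complete system with infinitely many points, any `S` of size `k - 1` lies on infinitely
many blocks avoiding a given finite set of further points. -/
theorem infinite_blocks_through (hk : 1 ≤ k)
    (hline : ∀ S : Set P, S.encard = k → ∃! b : L, ∀ p ∈ S, I p b)
    (hcard : ∀ b : L, {p : P | I p b}.encard = n) [Infinite P] {S E : Set P}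
    (hS : S.encard = ((k - 1 : ℕ) : ℕ∞)) (hE : E.Finite) :
    {b : L | (∀ p ∈ S, I p b) ∧ ∀ p ∈ E, I p b → p ∈ S}.Infinite := by
  intro hfin
  have hSfin : S.Finite := Set.finite_of_encard_eq_coe hS
  have hpts : ∀ b, {p : P | I p b}.Finite := fun b => Set.finite_of_encard_eq_coe (hcard b)
  have hline' : ∀ q ∉ S, ∃! b : L, ∀ p ∈ insert q S, I p b := by
    intro q hq
    refine hline _ ?_
    rw [Set.encard_insert_of_notMem hq, hS]
    exact_mod_cast Nat.sub_add_cancel hk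
  have : Nonempty L := by
    obtain ⟨q, hq⟩ := hSfin.exists_notMem
    exact (hline' q hq).exists.nonempty
  choose! B hB hBuniq using hline'
  have hbad : (S ∪ E ∪ (⋃ p ∈ E, {q | I q (B p)}) ∪
      ⋃ b ∈ {b : L | (∀ p ∈ S, I p b) ∧ ∀ p ∈ E, I p b → p ∈ S}, {q | I q b}).Finite :=
    ((hSfin.union hE).union (hE.biUnion fun _ _ => hpts _)).union
      (hfin.biUnion fun _ _ => hpts _)
  obtain ⟨q, hq⟩ := hbad.exists_notMem
  simp only [Set.mem_union, Set.mem_iUnion, Set.mem_ofPred_eq, not_or, not_exists] at hq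
  obtain ⟨⟨⟨hqS, hqE⟩, hqB⟩, hqb⟩ := hq
  have hBq := hB q hqS
  refine hqb (B q) ⟨fun p hp => hBq p (Or.inr hp), fun p hpE hp => ?_⟩ (hBq q (Or.inl rfl))
  by_contra hpS
  have : B q = B p := hBuniq p hpS _ (by
    rintro x (rfl | hx)
    · exact hp
    · exact hBq x (Or.inr hx))
  exact hqB p hpE (this ▸ hBq q (Or.inl rfl))

theorem steinerGeneric_of_complete (hk : 2 ≤ k)
    (hopen : IsOpen k I Set.univ)
    (hline : ∀ S : Set P, S.encard = k → ∃! b : L, ∀ p ∈ S, I p b)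
    (hcard : ∀ b : L, {p : P | I p b}.encard = n) [Infinite P] : SteinerGeneric k n I := by
  refine ⟨hopen, hline, hcard, fun D hD S hSD hSk => ?_, fun D hD => ?_⟩
  · set E : Set P := Sum.inl ⁻¹' D
    have hE : E.Finite := hD.preimage Sum.inl_injective.injOn
    have hSE : S ⊆ E := hSD
    obtain ⟨S', hSS', hS', hcardS'⟩ := Set.exists_superset_subset_encard_eq
      (s := S) (t := S ∪ Eᶜ) (k := ((k - 1 : ℕ) : ℕ∞)) Set.subset_union_left hSk
      (by rw [(hE.infinite_compl.mono Set.subset_union_right).encard_eq]; exact le_top)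
    refine (infinite_blocks_through (by omega) hline hcard hcardS' hE).mono ?_
    rintro b ⟨hb, hbE⟩
    exact ⟨fun p hp => hb p (hSS' hp), fun p hp hpb =>
      (hS' (hbE p hp hpb)).resolve_right fun h => h hp⟩
  · have : (⋃ b ∈ Sum.inr ⁻¹' D, {p : P | I p b}).Finite :=
      (hD.preimage Sum.inr_injective.injOn).biUnion fun b _ =>
        Set.finite_of_encard_eq_coe (hcard b)
    exact this.infinite_compl.mono fun p hp b hb hpb => (hp (Set.mem_biUnion hb hpb)).elim

end Completeness

/-- Formal points (sort `true`) and blocks (sort `false`) generated from `P` and `L` by adding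
points to blocks and blocks through `k`-tuples of points. -/
inductive Term (P L : Type) (k : ℕ) : Bool → Type
  | pt : P → Term P L k true
  | bl : L → Term P L k false
  | newp : Term P L k false → ℕ → Term P L k true
  | newb : (Fin k → Term P L k true) → Term P L k false

namespace Term

variable {P L : Type} {k : ℕ}

/-- The stage of the free completion at which a term appears. -/
def rank : {s : Bool} → Term P L k s → ℕ
  | _, pt _ => 0
  | _, bl _ => 0
  | _, newp b _ => rank b + 1
  | _, newb f => (Finset.univ.sup fun i => rank (f i)) + 1

theorem rank_lt_newb (f : Fin k → Term P L k true) (i : Fin k) : rank (f i) < rank (newb f) :=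
  Nat.lt_succ_of_le (Finset.le_sup (f := fun i => rank (f i)) (Finset.mem_univ i))

/-- The points incident with a block at the moment it is created. -/
def old (I : P → L → Prop) : Term P L k false → Set (Term P L k true)
  | bl b => pt '' {p | I p b}
  | newb f => Set.range f

/-- Incidence between formal points and blocks. -/
def Inc (I : P → L → Prop) (x : Term P L k true) (b : Term P L k false) : Prop :=
  x ∈ old I b ∨ ∃ j, x = newp b j

/-- A choice of one tuple among all those with the same range. -/
def Canonical {α : Type} (f : Fin k → α) : Prop :=
  (Quotient.mk (Setoid.ker Set.range) f).out = f

/-- No block through the tuple `f` is present before `newb f` is created. -/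
def Fresh (I : P → L → Prop) (f : Fin k → Term P L k true) : Prop :=
  ∀ c, (∀ i, Inc I (f i) c) → ∃ g, c = newb g ∧ Set.range f ⊆ Set.range g

/-- The terms denoting elements of the free completion of the system `I`. -/
def Valid (n : ℕ) (I : P → L → Prop) : {s : Bool} → Term P L k s → Prop
  | _, pt _ => True
  | _, bl _ => True
  | _, newp b j => Valid n I b ∧ j < n - (old I b).ncard
  | _, newb f => (∀ i, Valid n I (f i)) ∧ Function.Injective f ∧ Canonical f ∧ Fresh I f

theorem Canonical.eq_of_range_eq {α : Type} {f g : Fin k → α} (hf : Canonical f)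
    (hg : Canonical g) (h : Set.range f = Set.range g) : f = g := by
  rw [← hf, ← hg, Quotient.sound (s := Setoid.ker Set.range) (a := f) (b := g) h]

theorem exists_canonical {α : Type} {S : Set α} (hS : S.encard = k) :
    ∃ f : Fin k → α, f.Injective ∧ Canonical f ∧ Set.range f = S := by
  have hfin := Set.finite_of_encard_eq_coe hS
  have hcard : S.ncard = k := by simp [Set.ncard, hS]
  obtain ⟨f, hf⟩ : ∃ f : Fin k → α, Set.range f = S := by
    have := hfin.to_subtype
    exact ⟨fun i => ((Finite.equivFinOfCardEq hcard).symm i : S), by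
      rw [Set.range_comp' Subtype.val, Equiv.range_eq_univ]; simp⟩
  have hr : Set.range (Quotient.mk (Setoid.ker Set.range) f).out = S :=
    (Quotient.mk_out (s := Setoid.ker Set.range) f).trans hf
  refine ⟨(Quotient.mk (Setoid.ker Set.range) f).out, ?_, ?_, hr⟩
  · rw [← Set.injOn_univ]
    refine Set.injOn_of_ncard_image_eq ?_ Set.finite_univ
    rw [Set.image_univ, hr, hcard]
    simp [Set.ncard_univ]
  · exact congrArg Quotient.out (Quotient.out_eq _)

section

variable {n : ℕ} {I : P → L → Prop}

theorem Inc.rank_le {x : Term P L k true} {b : Term P L k false} (h : Inc I x b)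
    (hb : rank x ≤ rank b) : x ∈ old I b := by
  rcases h with h | ⟨j, rfl⟩
  · exact h
  · simp [rank] at hb

theorem rank_le_of_mem_old {x : Term P L k true} {b : Term P L k false} (h : x ∈ old I b) :
    rank x ≤ rank b := by
  cases b with
  | bl b => obtain ⟨p, -, rfl⟩ := h; simp [rank]
  | newb f => obtain ⟨i, rfl⟩ := h; exact (rank_lt_newb f i).le

theorem newp_notMem_old (b : Term P L k false) (j : ℕ) : newp b j ∉ old I b := fun h => by
  simpa [rank] using rank_le_of_mem_old h

theorem Valid.of_mem_old {x : Term P L k true} {b : Term P L k false} (hb : Valid n I b)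
    (h : x ∈ old I b) : Valid n I x := by
  cases b with
  | bl b => obtain ⟨p, -, rfl⟩ := h; simp [Valid]
  | newb f => obtain ⟨i, rfl⟩ := h; exact hb.1 i

/-- A formal point added to a block `c` lies on `c` and on later blocks only. -/
theorem Inc.newp_cases {b c : Term P L k false} {j : ℕ} (h : Inc I (newp c j) b) :
    b = c ∨ rank (newp c j) < rank b := by
  rcases h with h | ⟨i, hi⟩
  · cases b with
    | bl d => obtain ⟨p, -, hp⟩ := h; cases hp
    | newb f => obtain ⟨i, hi⟩ := h; exact Or.inr (hi ▸ rank_lt_newb f i)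
  · simp only [newp.injEq] at hi
    exact Or.inl hi.1.symm

theorem encard_old_le (hkn : k ≤ n) (hI : ∀ b, {p | I p b}.encard ≤ n)
    (b : Term P L k false) : (old I b).encard ≤ n := by
  cases b with
  | bl b => exact (Set.encard_image_le _ _).trans (hI b)
  | newb f =>
    rw [old, ← Set.image_univ]
    refine (Set.encard_image_le _ _).trans ?_
    simpa using hkn

theorem old_encard_newb {f : Fin k → Term P L k true} (hf : f.Injective) :
    (old I (newb f)).encard = k := by
  rw [old, ← Set.image_univ, hf.encard_image]
  simp

theorem eq_newb_of_inc {f : Fin k → Term P L k true} {b : Term P L k false}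
    (hf : Valid n I (newb f)) (hb : Valid n I b) (h : ∀ i, Inc I (f i) b) : b = newb f := by
  obtain ⟨g, rfl, hg⟩ := hf.2.2.2 b h
  have : Set.range f = Set.range g := (Set.finite_range f).eq_of_subset_of_encard_le hg (by
    have h1 := old_encard_newb (I := I) hf.2.1
    have h2 := old_encard_newb (I := I) hb.2.1
    simp only [old] at h1 h2
    rw [h1, h2])
  rw [hf.2.2.1.eq_of_range_eq hb.2.2.1 this]

/-- Any `k` points lie on at most one common block of the free completion. -/
theorem eq_of_inc (hpartial : IsPartial k n I Set.univ) {S : Set (Term P L k true)}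
    (hS : S.encard = k) {b c : Term P L k false} (hb : Valid n I b) (hc : Valid n I c)
    (hSb : ∀ x ∈ S, Inc I x b) (hSc : ∀ x ∈ S, Inc I x c) : b = c := by
  have key : ∀ {b c : Term P L k false}, Valid n I b → Valid n I c → (∀ x ∈ S, Inc I x b) →
      (∀ x ∈ S, Inc I x c) → b = c ∨ rank b + 1 < rank c ∨ S ⊆ old I b ∧ ∃ d, b = bl d := by
    intro b c hb hc hSb hSc
    by_cases hsub : S ⊆ old I b
    · cases b with
      | bl d => exact Or.inr (Or.inr ⟨hsub, d, rfl⟩)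
      | newb f =>
        left
        have : S = Set.range f := (Set.finite_of_encard_eq_coe hS).eq_of_subset_of_encard_le hsub
          ((old_encard_newb (I := I) hb.2.1).trans hS.symm).le
        exact (eq_newb_of_inc hb hc fun i => hSc _ (this ▸ Set.mem_range_self i)).symm
    · obtain ⟨x, hx, hxb⟩ := Set.not_subset.1 hsub
      obtain ⟨j, rfl⟩ := (hSb x hx).resolve_left hxb
      rcases (hSc _ hx).newp_cases with h | h
      · exact Or.inl h.symm
      · exact Or.inr (Or.inl h)
  rcases key hb hc hSb hSc with h | h | ⟨h, d, rfl⟩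
  · exact h
  · rcases key hc hb hSc hSb with h' | h' | ⟨-, e, rfl⟩
    · exact h'.symm
    · omega
    · simp [rank] at h
  · rcases key hc hb hSc hSb with h' | h' | ⟨h', e, rfl⟩
    · exact h'.symm
    · simp [rank] at h'
    · obtain ⟨S₀, rfl⟩ : ∃ S₀, pt '' S₀ = S :=
        Set.subset_range_iff_exists_image_eq.1 (h.trans (Set.image_subset_range _ _))
      have hinj : Function.Injective (pt : P → Term P L k true) := fun p q h => by simpa using h
      rw [hinj.encard_image] at hS
      have hmem : ∀ d : L, pt '' S₀ ⊆ old I (bl d : Term P L k false) → ∀ p ∈ S₀, I p d :=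
        fun d hd p hp => by simpa [old] using hd (Set.mem_image_of_mem _ hp)
      rw [hpartial.1 S₀ (fun _ _ => trivial) hS d e trivial trivial (hmem d h) (hmem e h')]

theorem exists_inc {S : Set (Term P L k true)} (hS : S.encard = k)
    (hV : ∀ x ∈ S, Valid n I x) : ∃ b, Valid n I b ∧ ∀ x ∈ S, Inc I x b := by
  obtain ⟨f, hf, hcan, rfl⟩ := exists_canonical hS
  by_cases hfresh : Fresh I f
  · refine ⟨newb f, ⟨fun i => hV _ ⟨i, rfl⟩, hf, hcan, hfresh⟩, fun x hx => Or.inl hx⟩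
  · simp only [Fresh, not_forall] at hfresh
    obtain ⟨c, hc, hnot⟩ := hfresh
    refine ⟨c, ?_, by rintro _ ⟨i, rfl⟩; exact hc i⟩
    cases c with
    | bl d => trivial
    | newb g =>
      have : ¬ Set.range f ⊆ Set.range g := fun h => hnot ⟨g, rfl, h⟩
      obtain ⟨_, ⟨i, rfl⟩, hi⟩ := Set.not_subset.1 this
      obtain ⟨j, hj⟩ := (hc i).resolve_left hi
      have := hV _ ⟨i, rfl⟩
      rw [hj] at this
      exact this.1

theorem encard_inc (hkn : k ≤ n) (hI : ∀ b, {p | I p b}.encard ≤ n)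
    {b : Term P L k false} (hb : Valid n I b) :
    {x : Term P L k true | Valid n I x ∧ Inc I x b}.encard = n := by
  have hle := encard_old_le hkn hI b
  have hfin : (old I b).Finite := Set.finite_of_encard_le_coe hle
  have hle' : (old I b).ncard ≤ n := by
    rw [← hfin.cast_ncard_eq] at hle; exact_mod_cast hle
  have heq : {x : Term P L k true | Valid n I x ∧ Inc I x b} =
      old I b ∪ newp b '' Set.Iio (n - (old I b).ncard) := by
    ext x
    constructor
    · rintro ⟨hx, h | ⟨j, rfl⟩⟩
      · exact Or.inl h
      · exact Or.inr ⟨j, hx.2, rfl⟩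
    · rintro (h | ⟨j, hj, rfl⟩)
      · exact ⟨hb.of_mem_old h, Or.inl h⟩
      · exact ⟨⟨hb, hj⟩, Or.inr ⟨j, rfl⟩⟩
  have hinj : Function.Injective (newp b) := fun i j h => by simpa using h
  rw [heq, Set.encard_union_eq, hinj.encard_image, ← hfin.cast_ncard_eq]
  · have : (Set.Iio (n - (old I b).ncard)).encard = ((n - (old I b).ncard : ℕ) : ℕ∞) := by
      rw [← Finset.coe_Iio, Set.encard_coe_eq_coe_finsetCard, Nat.card_Iio]
    rw [this]
    exact_mod_cast Nat.add_sub_cancel' hle'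
  · rw [Set.disjoint_left]
    rintro _ h ⟨j, -, rfl⟩
    exact newp_notMem_old b j h

end

/-- An encoding of terms by a `W`-type. -/
def encode : {s : Bool} → Term P L k s →
    WType (α := (P ⊕ L) ⊕ ℕ ⊕ Unit)
      (Sum.elim (fun _ => Empty) (Sum.elim (fun _ => Unit) (fun _ => Fin k)))
  | _, pt p => ⟨Sum.inl (Sum.inl p), Empty.elim⟩
  | _, bl b => ⟨Sum.inl (Sum.inr b), Empty.elim⟩
  | _, newp b j => ⟨Sum.inr (Sum.inl j), fun _ => encode b⟩
  | _, newb f => ⟨Sum.inr (Sum.inr ()), fun i => encode (f i)⟩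

theorem encode_inj {s : Bool} (x y : Term P L k s) (h : encode x = encode y) : x = y := by
  induction x with
  | pt p =>
    cases y with
    | pt q => cases h; rfl
    | newp c i => cases h
  | bl b =>
    cases y with
    | bl c => cases h; rfl
    | newb g => cases h
  | newp b j ih =>
    cases y with
    | pt p => cases h
    | newp c i =>
      injection h with h₁ h₂
      cases h₁
      rw [ih c (congrFun h₂ ())]
  | newb f ih =>
    cases y with
    | bl b => cases h
    | newb g =>
      injection h with h₁ h₂
      exact congrArg newb (funext fun i => ih i _ (congrFun h₂ i))

theorem mk_le (s : Bool) :
    Cardinal.mk (Term P L k s) ≤ Cardinal.mk (P ⊕ L) + Cardinal.aleph0 := by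
  have : ∀ a : (P ⊕ L) ⊕ ℕ ⊕ Unit, Finite
      (Sum.elim (fun _ => Empty) (Sum.elim (fun _ => Unit) (fun _ => Fin k)) a : Type) := by
    rintro (_ | _ | _) <;> dsimp <;> infer_instance
  refine (Cardinal.mk_le_of_injective (fun x y h => encode_inj (s := s) x y h)).trans
    (WType.cardinalMk_le_max_aleph0_of_finite.trans (max_le ?_ le_add_self))
  simp

end Term

namespace Term

section Choice

variable {Q M : Type} {k n : ℕ} {J : Q → M → Prop}

/-- Distinct points of the block `c` outside `O`. -/
noncomputable def pick [Nonempty Q] (n : ℕ) (J : Q → M → Prop) (c : M) (O : Set Q) : ℕ → Q :=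
  Classical.epsilon fun g => Set.InjOn g (Set.Iio (n - O.ncard)) ∧
    ∀ j < n - O.ncard, J (g j) c ∧ g j ∉ O

/-- A block through all points of `S`. -/
noncomputable def join [Nonempty M] (J : Q → M → Prop) (S : Set Q) : M :=
  Classical.epsilon fun b => ∀ p ∈ S, J p b

theorem pick_spec [Nonempty Q] (hcard : ∀ b : M, {p | J p b}.encard = n) {c : M} {O : Set Q}
    (hO : O ⊆ {p | J p c}) : Set.InjOn (pick n J c O) (Set.Iio (n - O.ncard)) ∧
    ∀ j < n - O.ncard, J (pick n J c O j) c ∧ pick n J c O j ∉ O := by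
  apply Classical.epsilon_spec (p := fun g : ℕ → Q => Set.InjOn g (Set.Iio (n - O.ncard)) ∧
    ∀ j < n - O.ncard, J (g j) c ∧ g j ∉ O)
  have hfin : {p | J p c}.Finite := Set.finite_of_encard_eq_coe (hcard c)
  have hc : ({p | J p c} \ O).ncard = n - O.ncard := by
    rw [Set.ncard_sdiff hO (hfin.subset hO)]
    simp [Set.ncard, hcard c]
  have : Finite ↥({p | J p c} \ O) := hfin.sdiff
  let e := (Finite.equivFinOfCardEq hc).symm
  refine ⟨fun j => if h : j < n - O.ncard then e ⟨j, h⟩ else Classical.arbitrary Q, ?_, ?_⟩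
  · intro i hi j hj hij
    rw [Set.mem_Iio] at hi hj
    simpa [hi, hj, Subtype.val_injective.eq_iff] using hij
  · intro j hj
    simp only [hj, dif_pos]
    exact (e ⟨j, hj⟩).2

theorem join_spec [Nonempty M] (hline : ∀ S : Set Q, S.encard = k → ∃! b : M, ∀ p ∈ S, J p b)
    {S : Set Q} (hS : S.encard = k) : ∀ p ∈ S, J p (join J S) :=
  Classical.epsilon_spec (p := fun b => ∀ p ∈ S, J p b) (hline S hS).exists

end Choice

section Realize

variable {P L Q M : Type} {k : ℕ} (n : ℕ) (I : P → L → Prop) (J : Q → M → Prop)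
  [Nonempty Q] [Nonempty M] (hp : P → Q) (hl : L → M)

/-- The interpretation of a term in a complete system: for a point, its image; for a block, its
image and the images of the points in `old`. The remaining components are junk. -/
noncomputable def realize : {s : Bool} → Term P L k s → Q × M × Set Q
  | _, pt p => (hp p, Classical.arbitrary M, ∅)
  | _, bl b => (Classical.arbitrary Q, hl b, hp '' {p | I p b})
  | _, newp b j => (pick n J (realize b).2.1 (realize b).2.2 j, Classical.arbitrary M, ∅)
  | _, newb f => (Classical.arbitrary Q, join J (Set.range fun i => (realize (f i)).1),
      Set.range fun i => (realize (f i)).1)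

/-- The image of a formal point. -/
noncomputable def mapPt (x : Term P L k true) : Q := (realize n I J hp hl x).1

/-- The image of a formal block. -/
noncomputable def mapBl (b : Term P L k false) : M := (realize n I J hp hl b).2.1

/-- The image of the elements of rank at most `r`. -/
def stage (k r : ℕ) : Set (Q ⊕ M) :=
  {y | (∃ x : Term P L k true, Valid n I x ∧ rank x ≤ r ∧ Sum.inl (mapPt n I J hp hl x) = y) ∨
    ∃ b : Term P L k false, Valid n I b ∧ rank b ≤ r ∧ Sum.inr (mapBl n I J hp hl b) = y}

/-- The interpretation restricted to elements of rank at most `r` is an open embedding. -/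
structure StageEmbeds (k r : ℕ) : Prop where
  injPt : ∀ x y : Term P L k true, Valid n I x → Valid n I y → rank x ≤ r → rank y ≤ r →
    mapPt n I J hp hl x = mapPt n I J hp hl y → x = y
  injBl : ∀ b c : Term P L k false, Valid n I b → Valid n I c → rank b ≤ r → rank c ≤ r →
    mapBl n I J hp hl b = mapBl n I J hp hl c → b = c
  inc : ∀ (x : Term P L k true) (b : Term P L k false), Valid n I x → Valid n I b →
    rank x ≤ r → rank b ≤ r → (J (mapPt n I J hp hl x) (mapBl n I J hp hl b) ↔ Inc I x b)
  openOver : OpenOver k J (stage n I J hp hl k r) Set.univ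

variable {n I J hp hl}

theorem mapPt_newp (b : Term P L k false) (j : ℕ) : mapPt n I J hp hl (newp b j) =
    pick n J (mapBl n I J hp hl b) (mapPt n I J hp hl '' old I b) j := by
  have : (realize n I J hp hl b).2.2 = mapPt n I J hp hl '' old I b := by
    cases b with
    | bl b => simp only [realize, old, Set.image_image]; rfl
    | newb f => simp only [realize, old, ← Set.range_comp]; rfl
  rw [← this]
  rfl

theorem mapBl_newb (f : Fin k → Term P L k true) : mapBl n I J hp hl (newb f) =
    join J (mapPt n I J hp hl '' Set.range f) := by
  rw [← Set.range_comp]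
  rfl

theorem stage_mono : Monotone (stage n I J hp hl k) := by
  rintro r s hrs y (⟨x, hx, hr, h⟩ | ⟨x, hx, hr, h⟩)
  · exact Or.inl ⟨x, hx, hr.trans hrs, h⟩
  · exact Or.inr ⟨x, hx, hr.trans hrs, h⟩

theorem stageEmbeds_zero (hpi : hp.Injective) (hli : hl.Injective)
    (hJ : ∀ p b, J (hp p) (hl b) ↔ I p b)
    (hopen : OpenOver k J (Set.range (Sum.map hp hl)) Set.univ) :
    StageEmbeds n I J hp hl k 0 where
  injPt x y _ _ hx hy h := by
    cases x <;> cases y <;> simp [rank] at hx hy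
    exact congrArg pt (hpi h)
  injBl b c _ _ hb hc h := by
    cases b <;> cases c <;> simp [rank] at hb hc
    exact congrArg bl (hli h)
  inc x b _ _ hx hb := by
    cases x <;> cases b <;> simp [rank] at hx hb
    refine (hJ _ _).trans ?_
    simp [Inc, old]
  openOver := by
    convert hopen
    ext y
    constructor
    · rintro (⟨x, -, hx, rfl⟩ | ⟨b, -, hb, rfl⟩)
      · cases x <;> simp [rank] at hx
        exact ⟨Sum.inl _, rfl⟩
      · cases b <;> simp [rank] at hb
        exact ⟨Sum.inr _, rfl⟩
    · rintro ⟨p | b, rfl⟩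
      · exact Or.inl ⟨pt p, trivial, le_rfl, rfl⟩
      · exact Or.inr ⟨bl b, trivial, le_rfl, rfl⟩

namespace StageEmbeds

variable {r : ℕ}

theorem newb_spec (h : StageEmbeds n I J hp hl k r)
    (hline : ∀ S : Set Q, S.encard = k → ∃! b : M, ∀ p ∈ S, J p b)
    {f : Fin k → Term P L k true} (hf : Valid n I (newb f)) (hr : rank (newb f) = r + 1) :
    Sum.inr (mapBl n I J hp hl (newb f)) ∉ stage n I J hp hl k r ∧
    bound k (Sum.inr (mapBl n I J hp hl (newb f)) : Q ⊕ M) ≤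
      (nbrs J (stage n I J hp hl k r) (Sum.inr (mapBl n I J hp hl (newb f)))).encard ∧
    ∀ x, Valid n I x → rank x ≤ r →
      (J (mapPt n I J hp hl x) (mapBl n I J hp hl (newb f)) ↔ x ∈ Set.range f) := by
  have hrf : ∀ i, rank (f i) ≤ r := fun i => by have := rank_lt_newb f i; omega
  set S : Set Q := mapPt n I J hp hl '' Set.range f with hSdef
  have hS : S.encard = k := by
    rw [hSdef, Set.InjOn.encard_image]
    · exact old_encard_newb (I := I) hf.2.1
    · rintro _ ⟨i, rfl⟩ _ ⟨j, rfl⟩ hij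
      exact h.injPt _ _ (hf.1 i) (hf.1 j) (hrf i) (hrf j) hij
  have hJ : ∀ p ∈ S, J p (mapBl n I J hp hl (newb f)) := by
    rw [mapBl_newb]
    exact join_spec hline hS
  have hsub : Sum.inl '' S ⊆
      nbrs J (stage n I J hp hl k r) (Sum.inr (mapBl n I J hp hl (newb f))) := by
    rintro _ ⟨p, hpS, rfl⟩
    refine ⟨?_, hJ p hpS⟩
    obtain ⟨_, ⟨i, rfl⟩, rfl⟩ := hpS
    exact Or.inl ⟨f i, hf.1 i, hrf i, rfl⟩
  have hnot : Sum.inr (mapBl n I J hp hl (newb f)) ∉ stage n I J hp hl k r := by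
    rintro (⟨x, -, -, hx⟩ | ⟨c, hc, hcr, hcf⟩)
    · cases hx
    · have : c = newb f := by
        refine eq_newb_of_inc hf hc fun i => (h.inc _ _ (hf.1 i) hc (hrf i) hcr).1 ?_
        rw [Sum.inr_injective hcf]
        exact hJ _ ⟨_, ⟨i, rfl⟩, rfl⟩
      rw [this] at hcr
      omega
  have hcardS : (Sum.inl '' S : Set (Q ⊕ M)).encard = k := by
    rw [Sum.inl_injective.encard_image, hS]
  refine ⟨hnot, hcardS.ge.trans (Set.encard_le_encard hsub), fun x hx hxr => ⟨fun hxJ => ?_, ?_⟩⟩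
  · have heq := (Set.finite_of_encard_eq_coe hcardS).eq_of_subset_of_encard_le hsub
      ((h.openOver.encard_nbrs_le hnot).trans hcardS.ge)
    have hmem : Sum.inl (mapPt n I J hp hl x) ∈
        nbrs J (stage n I J hp hl k r) (Sum.inr (mapBl n I J hp hl (newb f))) :=
      ⟨Or.inl ⟨x, hx, hxr, rfl⟩, hxJ⟩
    rw [← heq] at hmem
    obtain ⟨_, ⟨_, ⟨i, rfl⟩, rfl⟩, hi⟩ := hmem
    exact ⟨i, h.injPt _ _ (hf.1 i) hx (hrf i) hxr (Sum.inl_injective hi)⟩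
  · rintro ⟨i, rfl⟩
    exact hJ _ ⟨_, ⟨i, rfl⟩, rfl⟩

theorem newp_pick (h : StageEmbeds n I J hp hl k r)
    (hcard : ∀ b : M, {p | J p b}.encard = n)
    {b : Term P L k false} (hb : Valid n I b) (hr : rank b ≤ r) :
    Set.InjOn (fun j => mapPt n I J hp hl (newp b j)) (Set.Iio (n - (old I b).ncard)) ∧
    ∀ j < n - (old I b).ncard, J (mapPt n I J hp hl (newp b j)) (mapBl n I J hp hl b) ∧
      mapPt n I J hp hl (newp b j) ∉ mapPt n I J hp hl '' old I b := by
  have hncard : (mapPt n I J hp hl '' old I b).ncard = (old I b).ncard :=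
    Set.InjOn.ncard_image fun x hx y hy hxy =>
      h.injPt x y (hb.of_mem_old hx) (hb.of_mem_old hy) ((rank_le_of_mem_old hx).trans hr)
        ((rank_le_of_mem_old hy).trans hr) hxy
  have := pick_spec hcard (c := mapBl n I J hp hl b) (O := mapPt n I J hp hl '' old I b) (by
    rintro _ ⟨x, hx, rfl⟩
    exact (h.inc x b (hb.of_mem_old hx) hb ((rank_le_of_mem_old hx).trans hr) hr).2 (Or.inl hx))
  simpa only [hncard, mapPt_newp] using this

theorem newp_spec (h : StageEmbeds n I J hp hl k r)
    (hcard : ∀ b : M, {p | J p b}.encard = n)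
    {b : Term P L k false} {j : ℕ} (hb : Valid n I (newp b j)) (hr : rank (newp b j) = r + 1) :
    Sum.inl (mapPt n I J hp hl (newp b j)) ∉ stage n I J hp hl k r ∧
    bound k (Sum.inl (mapPt n I J hp hl (newp b j)) : Q ⊕ M) ≤
      (nbrs J (stage n I J hp hl k r) (Sum.inl (mapPt n I J hp hl (newp b j)))).encard ∧
    ∀ c, Valid n I c → rank c ≤ r →
      (J (mapPt n I J hp hl (newp b j)) (mapBl n I J hp hl c) ↔ c = b) := by
  have hbr : rank b ≤ r := by simp only [rank] at hr; omega
  obtain ⟨hJ, hold⟩ := (h.newp_pick hcard hb.1 hbr).2 j hb.2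
  have hnot : Sum.inl (mapPt n I J hp hl (newp b j)) ∉ stage n I J hp hl k r := by
    rintro (⟨x, hx, hxr, hxj⟩ | ⟨c, -, -, hc⟩)
    · have hxj := Sum.inl_injective hxj
      rw [← hxj] at hJ
      rcases (h.inc x b hx hb.1 hxr hbr).1 hJ with hxb | ⟨i, rfl⟩
      · exact hold ⟨x, hxb, hxj⟩
      · simp only [rank] at hxr hr
        omega
    · cases hc
  have hmem : ∀ c, Valid n I c → rank c ≤ r →
      J (mapPt n I J hp hl (newp b j)) (mapBl n I J hp hl c) →
      Sum.inr (mapBl n I J hp hl c) ∈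
        nbrs J (stage n I J hp hl k r) (Sum.inl (mapPt n I J hp hl (newp b j))) :=
    fun c hc hcr hcJ => ⟨Or.inr ⟨c, hc, hcr, rfl⟩, hcJ⟩
  refine ⟨hnot, ?_, fun c hc hcr => ⟨fun hcJ => ?_, ?_⟩⟩
  · simpa [bound, Set.one_le_encard_iff_nonempty] using ⟨_, hmem b hb.1 hbr hJ⟩
  · have hle := h.openOver.encard_nbrs_le hnot
    have := Set.encard_le_one_iff.1 (by simpa [bound] using hle) _ _ (hmem c hc hcr hcJ)
      (hmem b hb.1 hbr hJ)
    exact h.injBl c b hc hb.1 hcr hbr (Sum.inr_injective this)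
  · rintro rfl
    exact hJ

/-- The elements of rank `r + 1` are realized by elements saturated over stage `r`. -/
theorem succ (h : StageEmbeds n I J hp hl k r)
    (hline : ∀ S : Set Q, S.encard = k → ∃! b : M, ∀ p ∈ S, J p b)
    (hcard : ∀ b : M, {p | J p b}.encard = n) : StageEmbeds n I J hp hl k (r + 1) where
  injPt := by
    have hne : ∀ x y : Term P L k true, Valid n I x → Valid n I y → rank x ≤ r →
        rank y = r + 1 → mapPt n I J hp hl x ≠ mapPt n I J hp hl y := by
      intro x y hx hy hxr hyr hxy
      cases y with
      | pt p => simp [rank] at hyr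
      | newp b j => exact (h.newp_spec hcard hy hyr).1 (Or.inl ⟨x, hx, hxr, congrArg _ hxy⟩)
    intro x y hx hy hxr hyr hxy
    rcases Nat.le_succ_iff.1 hxr with hxr | hxr <;> rcases Nat.le_succ_iff.1 hyr with hyr | hyr
    · exact h.injPt x y hx hy hxr hyr hxy
    · exact (hne x y hx hy hxr hyr hxy).elim
    · exact (hne y x hy hx hyr hxr hxy.symm).elim
    · cases x with
      | pt p => simp [rank] at hxr
      | newp b i =>
        cases y with
        | pt p => simp [rank] at hyr
        | newp c j =>
          have hbr : rank b ≤ r := by simp only [rank] at hxr; omega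
          have hcr : rank c ≤ r := by simp only [rank] at hyr; omega
          have hJ := ((h.newp_spec hcard hx hxr).2.2 b hx.1 hbr).2 rfl
          rw [hxy] at hJ
          obtain rfl := ((h.newp_spec hcard hy hyr).2.2 b hx.1 hbr).1 hJ
          rw [(h.newp_pick hcard hx.1 hbr).1 hx.2 hy.2 hxy]
  injBl := by
    have hne : ∀ b c : Term P L k false, Valid n I b → Valid n I c → rank b ≤ r →
        rank c = r + 1 → mapBl n I J hp hl b ≠ mapBl n I J hp hl c := by
      intro b c hb hc hbr hcr hbc
      cases c with
      | bl p => simp [rank] at hcr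
      | newb f => exact (h.newb_spec hline hc hcr).1 (Or.inr ⟨b, hb, hbr, congrArg _ hbc⟩)
    intro b c hb hc hbr hcr hbc
    rcases Nat.le_succ_iff.1 hbr with hbr | hbr <;> rcases Nat.le_succ_iff.1 hcr with hcr | hcr
    · exact h.injBl b c hb hc hbr hcr hbc
    · exact (hne b c hb hc hbr hcr hbc).elim
    · exact (hne c b hc hb hcr hbr hbc.symm).elim
    · cases b with
      | bl p => simp [rank] at hbr
      | newb f =>
        cases c with
        | bl p => simp [rank] at hcr
        | newb g =>
          refine eq_newb_of_inc hc hb fun i => Or.inl ?_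
          have hgr : rank (g i) ≤ r := by have := rank_lt_newb g i; omega
          refine ((h.newb_spec hline hb hbr).2.2 (g i) (hc.1 i) hgr).1 ?_
          rw [hbc]
          exact ((h.newb_spec hline hc hcr).2.2 (g i) (hc.1 i) hgr).2 ⟨i, rfl⟩
  inc := by
    intro x b hx hb hxr hbr
    rcases Nat.le_succ_iff.1 hxr with hxr | hxr <;> rcases Nat.le_succ_iff.1 hbr with hbr | hbr
    · exact h.inc x b hx hb hxr hbr
    · cases b with
      | bl p => simp [rank] at hbr
      | newb f =>
        rw [(h.newb_spec hline hb hbr).2.2 x hx hxr]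
        exact ⟨Or.inl, fun hi => hi.rank_le (by omega)⟩
    · cases x with
      | pt p => simp [rank] at hxr
      | newp c j =>
        rw [(h.newp_spec hcard hx hxr).2.2 b hb hbr]
        refine ⟨fun hbc => hbc ▸ Or.inr ⟨j, rfl⟩, fun hi => hi.newp_cases.resolve_right ?_⟩
        omega
    · cases b with
      | bl p => simp [rank] at hbr
      | newb f =>
        cases x with
        | pt p => simp [rank] at hxr
        | newp c j =>
          obtain ⟨hcn, hcb, -⟩ := h.newp_spec hcard hx hxr
          obtain ⟨hfn, hfb, -⟩ := h.newb_spec hline hb hbr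
          refine iff_of_false
            (fun hJ => h.openOver.not_adj_of_saturated hcn hfn hcb hfb hJ) fun hi => ?_
          obtain ⟨i, hi⟩ := hi.rank_le (by omega)
          have := rank_lt_newb f i
          rw [hi] at this
          omega
  openOver := by
    set Z : Set (Q ⊕ M) := {z | z ∉ stage n I J hp hl k r ∧
      bound k z ≤ (nbrs J (stage n I J hp hl k r) z).encard ∧ z ∈ stage n I J hp hl k (r + 1)}
    have hstage : stage n I J hp hl k (r + 1) = stage n I J hp hl k r ∪ Z := by
      refine Set.Subset.antisymm (fun z hz => ?_)
        (Set.union_subset (stage_mono r.le_succ) fun z hz => hz.2.2)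
      have hz' := hz
      rcases hz' with ⟨x, hx, hxr, rfl⟩ | ⟨b, hb, hbr, rfl⟩
      · rcases Nat.le_succ_iff.1 hxr with hxr | hxr
        · exact Or.inl (Or.inl ⟨x, hx, hxr, rfl⟩)
        · cases x with
          | pt p => simp [rank] at hxr
          | newp c j =>
            obtain ⟨h₁, h₂, -⟩ := h.newp_spec hcard hx hxr
            exact Or.inr ⟨h₁, h₂, hz⟩
      · rcases Nat.le_succ_iff.1 hbr with hbr | hbr
        · exact Or.inl (Or.inr ⟨b, hb, hbr, rfl⟩)
        · cases b with
          | bl p => simp [rank] at hbr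
          | newb f =>
            obtain ⟨h₁, h₂, -⟩ := h.newb_spec hline hb hbr
            exact Or.inr ⟨h₁, h₂, hz⟩
    rw [hstage]
    exact h.openOver.union_saturated (fun z hz => hz.1) fun z hz => hz.2.1

end StageEmbeds

end Realize

end Term

namespace Term

section Completion

variable {P L : Type} {k n : ℕ} {I : P → L → Prop}

variable (k n I) in
/-- Points of the free completion. -/
abbrev FreePt : Type := {x : Term P L k true // Valid n I x}

variable (k n I) in
/-- Blocks of the free completion. -/
abbrev FreeBl : Type := {b : Term P L k false // Valid n I b}

variable (k n I) in
/-- Incidence in the free completion. -/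
def FreeInc (x : FreePt k n I) (b : FreeBl k n I) : Prop := Inc I x.1 b.1

variable (k n I) in
/-- The original points in the free completion. -/
def inclPt (p : P) : FreePt k n I := ⟨pt p, trivial⟩

variable (k n I) in
/-- The original blocks in the free completion. -/
def inclBl (b : L) : FreeBl k n I := ⟨bl b, trivial⟩

theorem inclPt_injective : Function.Injective (inclPt k n I) := fun _ _ h =>
  pt.inj (congrArg Subtype.val h)

theorem inclBl_injective : Function.Injective (inclBl k n I) := fun _ _ h =>
  bl.inj (congrArg Subtype.val h)

theorem freeInc_incl (p : P) (b : L) :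
    FreeInc k n I (inclPt k n I p) (inclBl k n I b) ↔ I p b := by
  simp [FreeInc, Inc, inclPt, inclBl, old]

theorem freeInc_line (hpartial : IsPartial k n I Set.univ) (S : Set (FreePt k n I))
    (hS : S.encard = k) : ∃! b, ∀ p ∈ S, FreeInc k n I p b := by
  have hS' : (Subtype.val '' S).encard = k := by rw [Subtype.val_injective.encard_image, hS]
  obtain ⟨b, hb, hbS⟩ := exists_inc (n := n) (I := I) hS' (by rintro _ ⟨x, -, rfl⟩; exact x.2)
  refine ⟨⟨b, hb⟩, fun p hp => hbS _ ⟨p, hp, rfl⟩, fun c hc => Subtype.ext ?_⟩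
  exact eq_of_inc hpartial hS' c.2 hb (by rintro _ ⟨x, hx, rfl⟩; exact hc x hx) hbS

theorem freeInc_encard (hkn : k ≤ n) (hpartial : IsPartial k n I Set.univ)
    (b : FreeBl k n I) : {p | FreeInc k n I p b}.encard = n := by
  have hI : ∀ b, {p | I p b}.encard ≤ n := fun b => by
    simpa [pointsIn] using hpartial.2 b trivial
  rw [← encard_inc hkn hI b.2, ← Subtype.val_injective.encard_image]
  congr 1
  ext x
  simp [FreeInc, and_comm]

theorem freeInc_isPartial (hkn : k ≤ n) (hpartial : IsPartial k n I Set.univ) :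
    IsPartial k n (FreeInc k n I) Set.univ :=
  ⟨fun S _ hS _ _ _ _ hb hc => (freeInc_line hpartial S hS).unique hb hc, fun b _ => by
    simpa [pointsIn] using (freeInc_encard hkn hpartial b).le⟩

/-- The system is open in its free completion: in a finite set of new elements, one of maximal
rank is hyperfree. -/
theorem openOver_incl : OpenOver k (FreeInc k n I)
    (Set.range (Sum.map (inclPt k n I) (inclBl k n I))) Set.univ := by
  intro C hC hfin hne
  obtain ⟨c, hc, hmax⟩ := Set.exists_max_image C
    (Sum.elim (fun x => rank x.1) fun b => rank b.1) hfin hne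
  refine ⟨c, hc, ?_⟩
  have hcA := (hC hc).2
  rcases c with ⟨x, hx⟩ | ⟨b, hb⟩
  · cases x with
    | pt p => exact (hcA ⟨Sum.inl p, rfl⟩).elim
    | newp b j =>
      have key : ∀ c ∈ blocksIn (FreeInc k n I)
          (Set.range (Sum.map (inclPt k n I) (inclBl k n I)) ∪ C) ⟨newp b j, hx⟩, c.1 = b := by
        rintro c ⟨hcX, hcI⟩
        refine (Inc.newp_cases hcI).resolve_right fun hlt => ?_
        rcases hcX with ⟨p | d, hd⟩ | hcC
        · cases hd
        · cases hd
          simp [inclBl, rank] at hlt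
        · exact absurd (hmax _ hcC) (not_le.2 hlt)
      exact Set.encard_le_one_iff.2 fun c d hc hd =>
        Subtype.ext ((key c hc).trans (key d hd).symm)
  · cases b with
    | bl p => exact (hcA ⟨Sum.inr p, rfl⟩).elim
    | newb f =>
      have key : pointsIn (FreeInc k n I)
          (Set.range (Sum.map (inclPt k n I) (inclBl k n I)) ∪ C) ⟨newb f, hb⟩ ⊆
          Subtype.val ⁻¹' Set.range f := by
        rintro x ⟨hxX, hxI⟩
        refine Inc.rank_le hxI ?_
        rcases hxX with ⟨p | d, hd⟩ | hxC
        · cases hd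
          simp [inclPt, rank]
        · cases hd
        · exact hmax _ hxC
      calc _ ≤ _ := Set.encard_le_encard key
        _ ≤ (Set.range f).encard := Set.encard_preimage_val_le_encard_right _ _
        _ = k := old_encard_newb (I := I) hb.2.1
        _ ≤ k := le_rfl

theorem mk_completion [Infinite (FreePt k n I)] :
    Cardinal.mk (FreePt k n I ⊕ FreeBl k n I) = Cardinal.mk (P ⊕ L) + Cardinal.aleph0 := by
  have hinf : Cardinal.aleph0 ≤ Cardinal.mk (P ⊕ L) + Cardinal.aleph0 := le_add_self
  have hinf' : Infinite (FreePt k n I ⊕ FreeBl k n I) := inferInstance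
  rw [Cardinal.infinite_iff] at hinf'
  apply le_antisymm
  · rw [Cardinal.mk_sum, Cardinal.lift_id, Cardinal.lift_id]
    exact Cardinal.add_le_of_le hinf ((Cardinal.mk_subtype_le _).trans (mk_le true))
      ((Cardinal.mk_subtype_le _).trans (mk_le false))
  · exact Cardinal.add_le_of_le hinf'
      (Cardinal.mk_le_of_injective (inclPt_injective.sumMap inclBl_injective)) hinf'

theorem exists_embedding {Q M : Type} {J : Q → M → Prop} [Nonempty Q] [Nonempty M]
    (hline : ∀ S : Set Q, S.encard = k → ∃! b : M, ∀ p ∈ S, J p b)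
    (hcard : ∀ b : M, {p | J p b}.encard = n) {hp : P → Q} {hl : L → M}
    (hpi : hp.Injective) (hli : hl.Injective) (hJ : ∀ p b, J (hp p) (hl b) ↔ I p b)
    (hopen : OpenOver k J (Set.range (Sum.map hp hl)) Set.univ) :
    ∃ (fp : FreePt k n I → Q) (fl : FreeBl k n I → M),
      Function.Injective fp ∧ Function.Injective fl ∧
      (∀ p b, J (fp p) (fl b) ↔ FreeInc k n I p b) ∧
      (∀ p, fp (inclPt k n I p) = hp p) ∧ (∀ b, fl (inclBl k n I b) = hl b) ∧
      OpenOver k J (Set.range (Sum.map fp fl)) Set.univ := by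
  have hstage : ∀ r, StageEmbeds n I J hp hl k r := by
    intro r
    induction r with
    | zero => exact stageEmbeds_zero hpi hli hJ hopen
    | succ r ih => exact ih.succ hline hcard
  refine ⟨fun x => mapPt n I J hp hl x.1, fun b => mapBl n I J hp hl b.1,
    fun x y hxy => Subtype.ext ?_, fun b c hbc => Subtype.ext ?_, fun x b => ?_,
    fun _ => rfl, fun _ => rfl, ?_⟩
  · exact (hstage _).injPt _ _ x.2 y.2 (le_max_left _ _) (le_max_right _ _) hxy
  · exact (hstage _).injBl _ _ b.2 c.2 (le_max_left _ _) (le_max_right _ _) hbc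
  · exact (hstage _).inc _ _ x.2 b.2 (le_max_left _ _) (le_max_right _ _)
  · convert OpenOver.iUnion stage_mono fun r => (hstage r).openOver
    ext y
    rw [Set.mem_iUnion]
    constructor
    · rintro ⟨x | b, rfl⟩
      · exact ⟨_, Or.inl ⟨x.1, x.2, le_rfl, rfl⟩⟩
      · exact ⟨_, Or.inr ⟨b.1, b.2, le_rfl, rfl⟩⟩
    · rintro ⟨r, ⟨x, hx, -, rfl⟩ | ⟨b, hb, -, rfl⟩⟩
      · exact ⟨Sum.inl ⟨x, hx⟩, rfl⟩
      · exact ⟨Sum.inr ⟨b, hb⟩, rfl⟩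

end Completion

end Term

end Steiner

theorem stmt10 {P L : Type} (k n : ℕ) (hk : 2 ≤ k) (hkn : k < n)
    (I : P → L → Prop)
    (hpartial : IsPartial k n I (Set.univ : Set (P ⊕ L)))
    (hopen : IsOpen k I (Set.univ : Set (P ⊕ L)))
    (hpts : ((k + 1 : ℕ) : Cardinal) ≤ Cardinal.mk P)
    (hblks : ((k + 1 : ℕ) : Cardinal) ≤ Cardinal.mk L) :
    ∃ (P' L' : Type) (I' : P' → L' → Prop) (ip : P → P') (il : L → L'),
      Function.Injective ip ∧ Function.Injective il ∧
      (∀ (p : P) (b : L), I' (ip p) (il b) ↔ I p b) ∧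
      IsPartial k n I' (Set.univ : Set (P' ⊕ L')) ∧
      -- (i) A ≤_o F:
      OpenOver k I' (Set.range (Sum.map ip il)) Set.univ ∧
      -- (ii)–(vi):
      SteinerGeneric k n I' ∧
      -- (vii):
      Cardinal.mk (P' ⊕ L') = Cardinal.mk (P ⊕ L) + Cardinal.aleph0 ∧
      -- (viii):
      (∀ (P'' L'' : Type) (I'' : P'' → L'' → Prop),
        IsPartial k n I'' (Set.univ : Set (P'' ⊕ L'')) → SteinerGeneric k n I'' →
        ∀ (hp : P → P'') (hl : L → L''),
          Function.Injective hp → Function.Injective hl →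
          (∀ (p : P) (b : L), I'' (hp p) (hl b) ↔ I p b) →
          OpenOver k I'' (Set.range (Sum.map hp hl)) Set.univ →
          ∃ (fp : P' → P'') (fl : L' → L''),
            Function.Injective fp ∧ Function.Injective fl ∧
            (∀ (p : P') (b : L'), I'' (fp p) (fl b) ↔ I' p b) ∧
            (∀ p : P, fp (ip p) = hp p) ∧ (∀ b : L, fl (il b) = hl b) ∧
            OpenOver k I'' (Set.range (Sum.map fp fl)) Set.univ) := by
  have hL : Nontrivial L := Cardinal.one_lt_iff_nontrivial.1
    (lt_of_lt_of_le (by exact_mod_cast (by omega : 1 < k + 1)) hblks)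
  have hP : Nonempty P := Cardinal.mk_ne_zero_iff.1 fun h => by
    rw [h] at hpts
    exact absurd hpts (not_le.2 (by exact_mod_cast k.succ_pos))
  have hopen' := IsOpen.of_openOver
    (hopen.range Term.inclPt_injective Term.inclBl_injective (Term.freeInc_incl (k := k) (n := n)))
    Term.openOver_incl
  have hline := Term.freeInc_line hpartial
  have hcard := Term.freeInc_encard hkn.le hpartial
  have : Infinite (Term.FreePt k n I) := infinite_points_of_complete hk hkn hopen' hline hcard
    Term.inclBl_injective.nontrivial
  refine ⟨Term.FreePt k n I, Term.FreeBl k n I, Term.FreeInc k n I, Term.inclPt k n I,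
    Term.inclBl k n I, Term.inclPt_injective, Term.inclBl_injective, Term.freeInc_incl,
    Term.freeInc_isPartial hkn.le hpartial, Term.openOver_incl,
    steinerGeneric_of_complete hk hopen' hline hcard, Term.mk_completion, ?_⟩
  intro Q M J _ hgen hp hl hpi hli hJ hA
  have : Nonempty Q := hP.map hp
  have : Nonempty M := hL.to_nonempty.map hl
  exact Term.exists_embedding hgen.2.1 hgen.2.2.1 hpi hli hJ hA
end
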